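/- arXiv:2401.09842 — 4 statements merged into one kernel-verified Lean document; each statement's English description precedes it below -/
import Mathlib

section
/- As K → ∞, one has ∑_{n=1}^{K} σ(30n+1) = (8π²/5)·K² + O(K log K); that is, there exist constants C > 0 and K₀ such that for all K ≥ K₀, |∑_{n=1}^{K} σ(30n+1) − (8π²/5)·K²| ≤ C·K·log K. -/
open Finset Real

/-- The sum-of-divisors function `σ(n) = ∑_{d ∣ n} d`. -/
def sigma1 (n : ℕ) : ℕ := ∑ d ∈ n.divisors, d

/-- The sum of the `e ≤ M` with `e ≡ a` modulo `30`, in closed form. -/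
lemma sum_Icc_residue_eq {a : ℕ} (ha : 1 ≤ a) (ha' : a < 30) (M : ℕ) :
    (∑ e ∈ Icc 1 M, if e % 30 = a then (e : ℤ) else 0) =
      a * ((M + 30 - a) / 30 : ℕ) +
        15 * ((M + 30 - a) / 30 : ℕ) * (((M + 30 - a) / 30 : ℕ) - 1) := by
  induction M with
  | zero =>
    have h : (0 + 30 - a) / 30 = 0 := by omega
    rw [h]; simp
  | succ M ih =>
    rw [Finset.sum_Icc_succ_top (by omega), ih]
    split_ifs with h
    · have h1 : (M + 1 + 30 - a) / 30 = (M + 30 - a) / 30 + 1 := by omega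
      have h2 : M + 1 = a + 30 * ((M + 30 - a) / 30) := by omega
      rw [h1, h2]
      push_cast
      ring
    · have h1 : (M + 1 + 30 - a) / 30 = (M + 30 - a) / 30 := by omega
      rw [h1]; simp

lemma abs_sum_Icc_residue_sub_le {a : ℕ} (ha : 1 ≤ a) (ha' : a < 30) {M : ℕ} (hM : 1 ≤ M) :
    |60 * (∑ e ∈ Icc 1 M, if e % 30 = a then (e : ℤ) else 0) - (M : ℤ) ^ 2| ≤ 2000 * (M : ℤ) := by
  rw [sum_Icc_residue_eq ha ha']
  obtain ⟨u, hu⟩ : ∃ u : ℤ, u = 30 * ((M + 30 - a) / 30 : ℕ) - M := ⟨_, rfl⟩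
  generalize hq : (M + 30 - a) / 30 = q at *
  have h1 : 1 - (a : ℤ) ≤ u := by omega
  have h2 : u ≤ 30 - a := by omega
  have key : 60 * ((a : ℤ) * q + 15 * q * (q - 1)) - (M : ℤ) ^ 2 =
      M * (2 * a + 2 * u - 30) + u * (2 * a + u - 30) := by
    rw [show (M : ℤ) = 30 * q - u by omega]; ring
  have hM' : (1 : ℤ) ≤ M := by exact_mod_cast hM
  have hb : |u * (2 * a + u - 30)| ≤ 30 * 60 := by
    rw [abs_mul]
    refine mul_le_mul ?_ ?_ (abs_nonneg _) (by norm_num) <;> rw [abs_le] <;> constructor <;> omega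
  have hc : |(M : ℤ) * (2 * a + 2 * u - 30)| ≤ M * 30 := by
    rw [abs_mul, abs_of_nonneg (by omega : (0 : ℤ) ≤ M)]
    refine mul_le_mul_of_nonneg_left ?_ (by omega)
    rw [abs_le]; constructor <;> omega
  rw [key]
  refine (abs_add_le _ _).trans ?_
  linarith

lemma exists_inverse_mod_thirty {d : ℕ} (hd : d.Coprime 30) :
    ∃ a, 1 ≤ a ∧ a < 30 ∧ ∀ e, d * e % 30 = 1 ↔ e % 30 = a := by
  have table : ∀ r < 30, r.Coprime 30 →
      ∃ a < 30, 1 ≤ a ∧ ∀ s < 30, r * s % 30 = 1 ↔ s = a := by decide +kernel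
  obtain ⟨a, h1, h2, h3⟩ := table (d % 30) (Nat.mod_lt _ (by norm_num))
    (by rw [Nat.Coprime, ← Nat.gcd_rec, Nat.gcd_comm]; exact hd)
  refine ⟨a, h2, h1, fun e => ?_⟩
  rw [Nat.mul_mod]
  exact h3 _ (Nat.mod_lt _ (by norm_num))

lemma coprime_of_mul_mod_thirty_eq_one {d e : ℕ} (h : d * e % 30 = 1) : d.Coprime 30 := by
  have h1 : (d * e).Coprime 30 := by
    rw [Nat.Coprime, Nat.gcd_comm, Nat.gcd_rec, h]; simp
  exact h1.coprime_mul_right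

/-- Sum over the cofactors `e` of `d` among the numbers `m ≤ N` with `m ≡ 1` modulo `30`. -/
lemma abs_sum_cofactor_sub_le {N d : ℕ} (hd : 1 ≤ d) (hdN : d ≤ N) :
    |60 * (∑ e ∈ Icc 1 (N / d), if d * e % 30 = 1 then (e : ℝ) else 0) -
      (N : ℝ) ^ 2 * (if d.Coprime 30 then 1 / (d : ℝ) ^ 2 else 0)| ≤ 2002 * N * (d : ℝ)⁻¹ := by
  have hd0 : (0 : ℝ) < d := by exact_mod_cast hd
  split_ifs with hc
  · obtain ⟨a, h1, h2, h3⟩ := exists_inverse_mod_thirty hc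
    simp only [h3]
    have hM : 1 ≤ N / d := (Nat.one_le_div_iff (by omega)).2 hdN
    have hb : |60 * (∑ e ∈ Icc 1 (N / d), if e % 30 = a then (e : ℝ) else 0) -
        ((N / d : ℕ) : ℝ) ^ 2| ≤ 2000 * ((N / d : ℕ) : ℝ) := by
      have := abs_sum_Icc_residue_sub_le h1 h2 hM
      have h4 := (Int.cast_le (R := ℝ)).2 this
      push_cast at h4 ⊢
      exact h4
    have hle : ((N / d : ℕ) : ℝ) ≤ N / d := Nat.cast_div_le
    have hlt : (N : ℝ) / d < (N / d : ℕ) + 1 := by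
      rw [div_lt_iff₀ hd0]
      have := Nat.lt_mul_div_succ N (show 0 < d by omega)
      rw [mul_comm] at this
      exact_mod_cast this
    have hx : (N : ℝ) ^ 2 * (1 / (d : ℝ) ^ 2) = (N / d : ℝ) ^ 2 := by rw [div_pow]; ring
    have hy : 2002 * (N : ℝ) * (d : ℝ)⁻¹ = 2002 * (N / d : ℝ) := by ring
    rw [hx, hy]
    have hM' : (1 : ℝ) ≤ (N / d : ℕ) := by exact_mod_cast hM
    rw [abs_le] at hb ⊢
    constructor <;> nlinarith
  · rw [Finset.sum_eq_zero]
    · simp; positivity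
    · intro e _
      rw [if_neg fun h => hc (coprime_of_mul_mod_thirty_eq_one h)]

lemma hasSum_dvd_inv_sq {g : ℕ} (hg : g ≠ 0) :
    HasSum (fun n : ℕ => if g ∣ n then 1 / (n : ℝ) ^ 2 else 0) (1 / (g : ℝ) ^ 2 * (π ^ 2 / 6)) := by
  have hinj : Function.Injective (fun n : ℕ => g * n) := fun a b h =>
    Nat.eq_of_mul_eq_mul_left (by omega) h
  rw [← hinj.hasSum_iff]
  · convert hasSum_zeta_two.mul_left (1 / (g : ℝ) ^ 2) using 1
    · rfl
    · funext n
      simp [mul_pow, mul_comm]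
  · intro n hn
    rw [if_neg]
    rintro ⟨k, rfl⟩
    exact hn ⟨k, rfl⟩

lemma coprime_thirty_iff (n : ℕ) : n.Coprime 30 ↔ ¬ 2 ∣ n ∧ ¬ 3 ∣ n ∧ ¬ 5 ∣ n := by
  rw [show 30 = 2 * (3 * 5) by norm_num, Nat.coprime_mul_iff_right, Nat.coprime_mul_iff_right]
  simp only [Nat.coprime_comm (n := n), Nat.Prime.coprime_iff_not_dvd Nat.prime_two,
    Nat.Prime.coprime_iff_not_dvd Nat.prime_three, Nat.Prime.coprime_iff_not_dvd Nat.prime_five]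

lemma hasSum_coprime_thirty_inv_sq :
    HasSum (fun n : ℕ => if n.Coprime 30 then 1 / (n : ℝ) ^ 2 else 0) (8 * π ^ 2 / 75) := by
  have h := ((((((hasSum_zeta_two.sub (hasSum_dvd_inv_sq (g := 2) (by norm_num))).sub
    (hasSum_dvd_inv_sq (g := 3) (by norm_num))).sub
    (hasSum_dvd_inv_sq (g := 5) (by norm_num))).add
    (hasSum_dvd_inv_sq (g := 6) (by norm_num))).add
    (hasSum_dvd_inv_sq (g := 10) (by norm_num))).add
    (hasSum_dvd_inv_sq (g := 15) (by norm_num))).sub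
    (hasSum_dvd_inv_sq (g := 30) (by norm_num))
  convert h using 1
  · rfl
  · funext n
    have h6 : 6 ∣ n ↔ 2 ∣ n ∧ 3 ∣ n := by omega
    have h10 : 10 ∣ n ↔ 2 ∣ n ∧ 5 ∣ n := by omega
    have h15 : 15 ∣ n ↔ 3 ∣ n ∧ 5 ∣ n := by omega
    have h30 : 30 ∣ n ↔ 2 ∣ n ∧ 3 ∣ n ∧ 5 ∣ n := by omega
    simp only [coprime_thirty_iff, h6, h10, h15, h30]
    by_cases h2 : 2 ∣ n <;> by_cases h3 : 3 ∣ n <;> by_cases h5 : 5 ∣ n <;> simp [h2, h3, h5]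
  · push_cast; ring

lemma abs_partial_coprime_sub_le {N : ℕ} (hN : 1 ≤ N) :
    |(∑ d ∈ Icc 1 N, if d.Coprime 30 then 1 / (d : ℝ) ^ 2 else 0) - 8 * π ^ 2 / 75| ≤ 1 / (N : ℝ) := by
  set f : ℕ → ℝ := fun n => if n.Coprime 30 then 1 / (n : ℝ) ^ 2 else 0 with hf
  have hnn : ∀ n, 0 ≤ f n := fun n => by simp only [hf]; split_ifs <;> positivity
  have heq : ∑ d ∈ Icc 1 N, f d = ∑ d ∈ range (N + 1), f d := by
    rw [Finset.range_eq_Ico, Finset.sum_eq_sum_Ico_succ_bot (by omega)]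
    have : f 0 = 0 := by simp [hf]
    rw [this, zero_add]; rfl
  change |∑ d ∈ Icc 1 N, f d - _| ≤ _
  rw [heq, abs_sub_comm, abs_of_nonneg
    (sub_nonneg.2 (sum_le_hasSum _ (fun i _ => hnn i) hasSum_coprime_thirty_inv_sq)),
    sub_le_iff_le_add]
  refine le_of_tendsto hasSum_coprime_thirty_inv_sq.tendsto_sum_nat ?_
  filter_upwards [Filter.eventually_ge_atTop (N + 1)] with n hn
  obtain ⟨m, rfl⟩ : ∃ m, n = m + 1 := ⟨n - 1, by omega⟩
  have h1 := Finset.sum_range_add_sum_Ico f hn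
  have h2 : ∑ d ∈ Ico (N + 1) (m + 1), f d ≤ ∑ d ∈ Ioc N m, ((d : ℝ) ^ 2)⁻¹ := by
    rw [show Ico (N + 1) (m + 1) = Ioc N m by ext; simp]
    refine Finset.sum_le_sum fun i _ => ?_
    simp only [hf]; split_ifs
    · simp
    · positivity
  have h3 := sum_Ioc_inv_sq_le_sub (α := ℝ) (k := N) (n := m) (by omega) (by omega)
  have h4 : (0 : ℝ) ≤ (m : ℝ)⁻¹ := by positivity
  rw [one_div]
  linarith

lemma sum_sigma1_eq (K : ℕ) :
    ∑ n ∈ range (K + 1), sigma1 (30 * n + 1) =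
      ∑ d ∈ Icc 1 (30 * K + 1), ∑ e ∈ Icc 1 ((30 * K + 1) / d),
        if d * e % 30 = 1 then e else 0 := by
  simp only [sigma1, ← Finset.sum_filter]
  rw [Finset.sum_sigma', Finset.sum_sigma']
  refine Finset.sum_bij' (fun x _ => ⟨(30 * x.1 + 1) / x.2, x.2⟩) (fun x _ => ⟨x.1 * x.2 / 30, x.2⟩)
    ?_ ?_ ?_ ?_ ?_
  · rintro ⟨n, e⟩ h
    simp only [mem_sigma, mem_range, Nat.mem_divisors, mem_filter, mem_Icc] at h ⊢
    obtain ⟨hn, hd, -⟩ := h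
    have hpos : 0 < e := Nat.pos_of_dvd_of_pos hd (by omega)
    obtain ⟨d, hd⟩ := hd
    rw [hd, Nat.mul_div_cancel_left _ hpos]
    have hdpos : 0 < d := by
      rcases Nat.eq_zero_or_pos d with rfl | h
      · omega
      · exact h
    refine ⟨⟨hdpos, ?_⟩, ⟨hpos, ?_⟩, ?_⟩
    · nlinarith
    · rw [Nat.le_div_iff_mul_le hdpos]; omega
    · rw [mul_comm, ← hd]; omega
  · rintro ⟨d, e⟩ h
    simp only [mem_sigma, mem_range, Nat.mem_divisors, mem_filter, mem_Icc] at h ⊢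
    obtain ⟨⟨hd, -⟩, ⟨he, hle⟩, hm⟩ := h
    rw [Nat.le_div_iff_mul_le hd, mul_comm] at hle
    refine ⟨by omega, ⟨d, ?_⟩, by omega⟩
    rw [mul_comm e]; omega
  · rintro ⟨n, e⟩ h
    simp only [mem_sigma, mem_range, Nat.mem_divisors] at h ⊢
    rw [Nat.div_mul_cancel h.2.1]
    congr 1; omega
  · rintro ⟨d, e⟩ h
    simp only [mem_sigma, mem_filter, mem_Icc] at h ⊢
    obtain ⟨⟨hd, -⟩, ⟨he, hle⟩, hm⟩ := h
    rw [show 30 * (d * e / 30) + 1 = d * e by omega, Nat.mul_div_cancel _ (by omega)]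
  · simp

lemma abs_sum_sigma1_sub_le (K : ℕ) :
    |60 * (∑ n ∈ range (K + 1), (sigma1 (30 * n + 1) : ℝ)) -
      ((30 * K + 1 : ℕ) : ℝ) ^ 2 * (8 * π ^ 2 / 75)| ≤
      2002 * (30 * K + 1 : ℕ) * (1 + Real.log (30 * K + 1 : ℕ)) + (30 * K + 1 : ℕ) := by
  have h0 : (∑ n ∈ range (K + 1), (sigma1 (30 * n + 1) : ℝ)) =
      ∑ d ∈ Icc 1 (30 * K + 1), ∑ e ∈ Icc 1 ((30 * K + 1) / d),
        if d * e % 30 = 1 then (e : ℝ) else 0 := by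
    have := congrArg (Nat.cast (R := ℝ)) (sum_sigma1_eq K)
    push_cast at this
    exact this
  rw [h0]
  have hN : 1 ≤ 30 * K + 1 := by omega
  generalize 30 * K + 1 = N at *
  have hN0 : (0 : ℝ) < N := by exact_mod_cast hN
  set P : ℝ := ∑ d ∈ Icc 1 N, if d.Coprime 30 then 1 / (d : ℝ) ^ 2 else 0 with hP
  have h1 : |60 * (∑ d ∈ Icc 1 N, ∑ e ∈ Icc 1 (N / d), if d * e % 30 = 1 then (e : ℝ) else 0) -
      (N : ℝ) ^ 2 * P| ≤ 2002 * N * (1 + Real.log N) := by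
    rw [hP, Finset.mul_sum, Finset.mul_sum, ← Finset.sum_sub_distrib]
    refine (Finset.abs_sum_le_sum_abs _ _).trans ?_
    refine (Finset.sum_le_sum fun d hd =>
      abs_sum_cofactor_sub_le (mem_Icc.1 hd).1 (mem_Icc.1 hd).2).trans ?_
    rw [← Finset.mul_sum]
    refine mul_le_mul_of_nonneg_left ?_ (by positivity)
    have := harmonic_le_one_add_log N
    rw [harmonic_eq_sum_Icc] at this
    push_cast at this
    exact this
  have h2 : |(N : ℝ) ^ 2 * P - (N : ℝ) ^ 2 * (8 * π ^ 2 / 75)| ≤ (N : ℝ) := by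
    rw [← mul_sub, abs_mul, abs_of_nonneg (by positivity)]
    calc (N : ℝ) ^ 2 * _ ≤ (N : ℝ) ^ 2 * (1 / N) :=
          mul_le_mul_of_nonneg_left (abs_partial_coprime_sub_le hN) (by positivity)
      _ = N := by field_simp
  exact (abs_sub_le _ _ _).trans (add_le_add h1 h2)

/-- `∑_{n ≤ K} σ(30n+1) = (8π²/5) K² + O(K log K)`. -/
theorem stmt_6 :
    ∃ C : ℝ, 0 < C ∧ ∃ K₀ : ℕ, ∀ K : ℕ, K₀ ≤ K →
      |(∑ n ∈ Finset.Icc 1 K, sigma1 (30 * n + 1) : ℝ) - (8 * π ^ 2 / 5) * (K : ℝ) ^ 2| ≤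
        C * (K : ℝ) * Real.log K := by
  refine ⟨100000, by norm_num, 2, fun K hK => ?_⟩
  have hK2 : (2 : ℝ) ≤ K := by exact_mod_cast hK
  have hlog2 : (1 : ℝ) / 2 ≤ Real.log K := by
    have := Real.log_le_log (by norm_num) hK2
    linarith [Real.log_two_gt_d9]
  have hlogN : Real.log (30 * K + 1 : ℕ) ≤ 6 * Real.log K := by
    rw [← Nat.cast_ofNat (R := ℝ), ← Real.log_pow]
    refine Real.log_le_log (by positivity) ?_
    have h5 : 2 ^ 5 ≤ K ^ 5 := Nat.pow_le_pow_left hK 5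
    have : 30 * K + 1 ≤ K ^ 6 := by rw [pow_succ]; nlinarith
    exact_mod_cast this
  have hsum : (∑ n ∈ range (K + 1), (sigma1 (30 * n + 1) : ℝ)) =
      1 + ∑ n ∈ Icc 1 K, (sigma1 (30 * n + 1) : ℝ) := by
    rw [Finset.range_eq_Ico, Finset.sum_eq_sum_Ico_succ_bot (by omega)]
    congr 1
    simp [sigma1]
  have h := abs_sum_sigma1_sub_le K
  rw [hsum] at h
  generalize (∑ n ∈ Icc 1 K, (sigma1 (30 * n + 1) : ℝ)) = S at *
  generalize hl : Real.log (30 * K + 1 : ℕ) = l at *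
  generalize Real.log K = L at *
  push_cast at h
  have hpi : π ^ 2 ≤ 10 := by nlinarith [Real.pi_lt_d2, Real.pi_pos]
  have hpi0 : 0 ≤ π ^ 2 := by positivity
  have hKpi : (K : ℝ) * π ^ 2 ≤ K * 10 := mul_le_mul_of_nonneg_left hpi (by linarith)
  have hKpi0 : 0 ≤ (K : ℝ) * π ^ 2 := by positivity
  have hKl : (K : ℝ) * l ≤ K * (6 * L) := mul_le_mul_of_nonneg_left hlogN (by linarith)
  have hKL : (K : ℝ) * (1 / 2) ≤ K * L := mul_le_mul_of_nonneg_left hlog2 (by linarith)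
  have hLK : 2 * L ≤ K * L := mul_le_mul_of_nonneg_right hK2 (by linarith)
  rw [abs_le] at h ⊢
  constructor <;> nlinarith
end

section
/- The limit lim_{K→∞} (∑_{n=1}^{K} σ(30n)) / (∑_{n=1}^{K} σ(30n+1)) exists and equals 1595/576. -/
open Finset Filter

/-- Abel summation: a sequence with mean value `C` has mean `C / 2` when weighted by the index. -/
lemma tendsto_sum_natCast_mul_div_sq {g : ℕ → ℝ} {C : ℝ}
    (h : Tendsto (fun K : ℕ => (∑ n ∈ Icc 1 K, g n) / K) atTop (nhds C)) :
    Tendsto (fun K : ℕ => (∑ n ∈ Icc 1 K, (n : ℝ) * g n) / (K : ℝ) ^ 2) atTop (nhds (C / 2)) := by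
  set G : ℕ → ℝ := fun K => ∑ n ∈ Icc 1 K, g n with hG
  have hAbel : ∀ K : ℕ, ∑ n ∈ Icc 1 K, (n : ℝ) * g n = K * G K - ∑ n ∈ range K, G n := by
    intro K
    induction K with
    | zero => simp
    | succ K ih =>
      have hs : G (K + 1) = G K + g (K + 1) := sum_Icc_succ_top (by omega) _
      rw [sum_Icc_succ_top (by omega), ih, sum_range_succ, hs]
      push_cast
      ring
  have hid : ∀ K : ℕ, ∑ n ∈ range K, (n : ℝ) = K * (K - 1) / 2 := by
    intro K
    induction K with
    | zero => simp
    | succ K ih => rw [sum_range_succ, ih]; push_cast; ring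
  have hinv : Tendsto (fun K : ℕ => (1 : ℝ) / K) atTop (nhds 0) :=
    tendsto_one_div_atTop_nhds_zero_nat
  have hlit : (fun n : ℕ => G n - C * n) =o[atTop] (fun n : ℕ => (n : ℝ)) := by
    rw [Asymptotics.isLittleO_iff_tendsto' (by
      filter_upwards [eventually_gt_atTop 0] with n hn h0
      exact absurd h0 (by positivity))]
    have h2 : Tendsto (fun K : ℕ => G K / K - C) atTop (nhds 0) := by
      simpa using h.sub_const C
    refine h2.congr' ?_
    filter_upwards [eventually_gt_atTop 0] with n hn
    field_simp
  have htop : Tendsto (fun K : ℕ => ∑ n ∈ range K, (n : ℝ)) atTop atTop := by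
    refine tendsto_atTop_mono' _ ?_
      (tendsto_atTop_add_const_right _ (-1 : ℝ) tendsto_natCast_atTop_atTop)
    filter_upwards [eventually_ge_atTop 2] with n hn
    have : (2 : ℝ) ≤ n := by exact_mod_cast hn
    rw [hid]
    nlinarith
  have hsum := hlit.sum_range (fun n => Nat.cast_nonneg n) htop
  have hO : (fun K : ℕ => ∑ n ∈ range K, (n : ℝ)) =O[atTop] (fun K : ℕ => (K : ℝ) ^ 2) := by
    refine Asymptotics.IsBigO.of_bound 1 (Eventually.of_forall fun K => ?_)
    rw [Real.norm_of_nonneg (sum_nonneg fun n _ => Nat.cast_nonneg n),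
      Real.norm_of_nonneg (by positivity), hid]
    have : (0 : ℝ) ≤ K := Nat.cast_nonneg K
    nlinarith
  have hzero := (hsum.trans_isBigO hO).tendsto_div_nhds_zero
  have hall := (h.sub hzero).sub ((hinv.const_sub 1).const_mul (C / 2))
  have hC : C - 0 - C / 2 * (1 - 0) = C / 2 := by ring
  rw [hC] at hall
  refine hall.congr' ?_
  filter_upwards [eventually_gt_atTop 0] with K hK
  rw [hAbel, sum_sub_distrib, ← mul_sum, hid]
  change G K / K - _ - _ = _
  field_simp
  ring

lemma sigma1_eq_mul_sum {m M : ℕ} (hm : m ≠ 0) (hM : m ≤ M) :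
    (sigma1 m : ℝ) = m * ∑ d ∈ range (M + 1), if d ∣ m then (1 : ℝ) / d else 0 := by
  have hfilter : (range (M + 1)).filter (· ∣ m) = m.divisors := by
    ext d
    simp only [mem_filter, mem_range, Nat.mem_divisors]
    exact ⟨fun h => ⟨h.2, hm⟩, fun h => ⟨by have := Nat.le_of_dvd (by omega) h.1; omega, h.1⟩⟩
  rw [← sum_filter, hfilter, sigma1, ← Nat.sum_div_divisors, Nat.cast_sum, mul_sum]
  refine sum_congr rfl fun d hd => ?_
  have hd' := Nat.dvd_of_mem_divisors hd
  have hd0 : (d : ℝ) ≠ 0 := by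
    exact_mod_cast (Nat.pos_of_mem_divisors hd).ne'
  rw [Nat.cast_div hd' hd0]
  ring

/-- If the number of `1 ≤ n ≤ K` with `d ∣ 30 * n + b` is `c d * K / d + O(1)`, then
`∑ n ≤ K, σ(30 * n + b)` is asymptotic to `15 * (∑ d, c d / d ^ 2) * K ^ 2`. -/
lemma tendsto_sum_sigma1_div_sq {b : ℕ} (hb : b ≤ 1) {c : ℕ → ℝ} (hc : ∀ d, c d ≤ 30)
    (hcount : ∀ d K : ℕ, 0 < d →
      |(#{n ∈ Icc 1 K | d ∣ 30 * n + b} : ℝ) - c d * K / d| ≤ 1) :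
    Tendsto (fun K : ℕ => (∑ n ∈ Icc 1 K, (sigma1 (30 * n + b) : ℝ)) / (K : ℝ) ^ 2)
      atTop (nhds (15 * ∑' d : ℕ, c d / (d : ℝ) ^ 2)) := by
  set N : ℕ → ℕ → ℝ := fun d K => (#{n ∈ Icc 1 K | d ∣ 30 * n + b} : ℝ) with hN
  have hNzero : ∀ d K : ℕ, 31 * K < d → N d K = 0 := by
    intro d K hd
    simp only [hN, Nat.cast_eq_zero, card_eq_zero, filter_eq_empty_iff, mem_Icc]
    intro n hn hdvd
    have := Nat.le_of_dvd (by omega) hdvd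
    omega
  have hNle : ∀ d K : ℕ, 0 < d → N d K ≤ 61 * K / d := by
    intro d K hd
    have hd' : (0 : ℝ) < d := by exact_mod_cast hd
    rcases lt_or_ge (31 * K) d with h | h
    · rw [hNzero d K h]; positivity
    · have h1 := (abs_le.1 (hcount d K hd)).2
      have h2 : (d : ℝ) ≤ 31 * K := by exact_mod_cast h
      have h3 : c d * K / d ≤ 30 * K / d := by gcongr; exact hc d
      have h4 : (1 : ℝ) ≤ 31 * K / d := by rwa [le_div_iff₀ hd', one_mul]
      have h5 : (61 : ℝ) * K / d = 30 * K / d + 31 * K / d := by ring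
      linarith
  set g : ℕ → ℝ := fun n => (sigma1 (30 * n + b) : ℝ) / ((30 * n + b : ℕ) : ℝ) with hg
  have hGsum : ∀ K : ℕ, ∑ n ∈ Icc 1 K, g n = ∑' d : ℕ, N d K / d := by
    intro K
    rw [tsum_eq_sum (s := range (31 * K + 1)) (by
      intro d hd
      rw [hNzero d K (by simpa [Nat.lt_succ_iff] using hd), zero_div])]
    have hgn : ∀ n ∈ Icc 1 K,
        g n = ∑ d ∈ range (31 * K + 1), if d ∣ 30 * n + b then (1 : ℝ) / d else 0 := by
      intro n hn
      rw [mem_Icc] at hn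
      have hm : ((30 * n + b : ℕ) : ℝ) ≠ 0 := by
        exact_mod_cast (by omega : 30 * n + b ≠ 0)
      simp only [hg]
      rw [sigma1_eq_mul_sum (m := 30 * n + b) (M := 31 * K) (by omega) (by omega),
        mul_div_cancel_left₀ _ hm]
    rw [sum_congr rfl hgn, sum_comm]
    refine sum_congr rfl fun d _ => ?_
    rw [← sum_filter, sum_const, nsmul_eq_mul, mul_one_div]
  have hmean : Tendsto (fun K : ℕ => (∑ n ∈ Icc 1 K, g n) / K) atTop
      (nhds (∑' d : ℕ, c d / (d : ℝ) ^ 2)) := by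
    simp_rw [hGsum, ← tsum_div_const]
    refine tendsto_tsum_of_dominated_convergence (bound := fun d : ℕ => 61 * (1 / (d : ℝ) ^ 2))
      ((Real.summable_one_div_nat_pow.2 one_lt_two).mul_left 61) ?_ ?_
    · intro d
      rcases Nat.eq_zero_or_pos d with rfl | hd
      · simp
      have hd' : (0 : ℝ) < d := by exact_mod_cast hd
      rw [tendsto_iff_norm_sub_tendsto_zero]
      refine squeeze_zero' (Eventually.of_forall fun _ => norm_nonneg _) ?_
        tendsto_one_div_atTop_nhds_zero_nat
      filter_upwards [eventually_gt_atTop 0] with K hK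
      have hK' : (0 : ℝ) < K := by exact_mod_cast hK
      have heq : N d K / d / K - c d / (d : ℝ) ^ 2 = (N d K - c d * K / d) / (d * K) := by
        field_simp
      rw [heq, Real.norm_eq_abs, abs_div, abs_of_pos (mul_pos hd' hK')]
      have h1d : (1 : ℝ) ≤ d := by exact_mod_cast hd
      exact div_le_div₀ zero_le_one (hcount d K hd) hK' (le_mul_of_one_le_left hK'.le h1d)
    · filter_upwards [eventually_gt_atTop 0] with K hK d
      rcases Nat.eq_zero_or_pos d with rfl | hd
      · simp
      have hd' : (0 : ℝ) < d := by exact_mod_cast hd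
      have hK' : (0 : ℝ) < K := by exact_mod_cast hK
      have hNnn : 0 ≤ N d K := Nat.cast_nonneg _
      rw [Real.norm_of_nonneg (by positivity)]
      calc N d K / d / K ≤ 61 * K / d / d / K := by gcongr; exact hNle d K hd
        _ = 61 * (1 / (d : ℝ) ^ 2) := by field_simp
  have hweighted := (tendsto_sum_natCast_mul_div_sq hmean).const_mul 30
  have hrest := (hmean.mul tendsto_one_div_atTop_nhds_zero_nat).const_mul (b : ℝ)
  have hall := hweighted.add hrest
  have hlim : ∀ S : ℝ, 30 * (S / 2) + b * (S * 0) = 15 * S := fun S => by ring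
  rw [hlim] at hall
  refine hall.congr fun K => ?_
  have hsplit : ∑ n ∈ Icc 1 K, (sigma1 (30 * n + b) : ℝ)
      = 30 * ∑ n ∈ Icc 1 K, (n : ℝ) * g n + b * ∑ n ∈ Icc 1 K, g n := by
    rw [mul_sum, mul_sum, ← sum_add_distrib]
    refine sum_congr rfl fun n hn => ?_
    rw [mem_Icc] at hn
    have hm : ((30 * n + b : ℕ) : ℝ) ≠ 0 := by
      exact_mod_cast (by omega : 30 * n + b ≠ 0)
    have hs : (sigma1 (30 * n + b) : ℝ) = ((30 * n + b : ℕ) : ℝ) * g n :=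
      (mul_div_cancel₀ _ hm).symm
    rw [hs]
    push_cast
    ring
  rw [hsplit]
  ring

lemma Icc_one_eq_Ioc_zero (K : ℕ) : Icc 1 K = Ioc 0 K := by
  ext; simp [Nat.succ_le_iff]

lemma abs_card_dvd_mul_sub_le (a : ℕ) (d K : ℕ) (hd : 0 < d) :
    |(#{n ∈ Icc 1 K | d ∣ a * n + 0} : ℝ) - (d.gcd a : ℝ) * K / d| ≤ 1 := by
  obtain ⟨q, hq⟩ := Nat.gcd_dvd_left d a
  obtain ⟨e, he⟩ := Nat.gcd_dvd_right d a
  have hgpos : 0 < d.gcd a := Nat.gcd_pos_of_pos_left _ hd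
  have hqpos : 0 < q := Nat.pos_of_ne_zero (by rintro rfl; omega)
  have hcop : q.Coprime e := by
    have := Nat.coprime_div_gcd_div_gcd hgpos
    rwa [Nat.div_eq_of_eq_mul_right hgpos hq, Nat.div_eq_of_eq_mul_right hgpos he] at this
  have hiff : ∀ n, d ∣ a * n + 0 ↔ q ∣ n := by
    intro n
    have h : d ∣ a * n ↔ d.gcd a * q ∣ d.gcd a * (e * n) := by
      rw [← hq, ← mul_assoc, ← he]
    rw [add_zero, h, Nat.mul_dvd_mul_iff_left hgpos]
    exact hcop.dvd_mul_left
  have hqr : (0 : ℝ) < q := by exact_mod_cast hqpos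
  have hgr : (0 : ℝ) < d.gcd a := by exact_mod_cast hgpos
  have hdr : (d.gcd a : ℝ) * K / d = (K : ℝ) / q := by
    have : (d : ℝ) = d.gcd a * q := by exact_mod_cast hq
    rw [this, mul_div_mul_left _ _ hgr.ne']
  simp_rw [hiff]
  rw [Icc_one_eq_Ioc_zero, Nat.Ioc_filter_dvd_card_eq_div, hdr, ← Nat.floor_div_eq_div (K := ℝ),
    abs_le]
  have h1 := Nat.floor_le (a := (K : ℝ) / q) (by positivity)
  have h2 := Nat.lt_floor_add_one ((K : ℝ) / q)
  constructor <;> linarith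

lemma abs_card_modEq_sub_le (d v K : ℕ) (hd : 0 < d) :
    |(#{n ∈ Icc 1 K | n ≡ v [MOD d]} : ℝ) - (K : ℝ) / d| ≤ 1 := by
  have h := Nat.Ioc_filter_modEq_card 0 K hd v
  have hdq : (0 : ℚ) < d := by exact_mod_cast hd
  have hle : ((0 : ℕ) - v : ℚ) / d ≤ (K - v : ℚ) / d := by
    gcongr
    exact Nat.zero_le K
  rw [max_eq_left (by have := Int.floor_le_floor hle; omega)] at h
  have h' : (#{n ∈ Ioc 0 K | n ≡ v [MOD d]} : ℚ)
      = (⌊(K - v : ℚ) / d⌋ : ℚ) - (⌊((0 : ℕ) - v : ℚ) / d⌋ : ℚ) := by exact_mod_cast h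
  have key : |(#{n ∈ Ioc 0 K | n ≡ v [MOD d]} : ℚ) - (K : ℚ) / d| ≤ 1 := by
    have h1 := Int.floor_le ((K - v : ℚ) / d)
    have h2 := Int.lt_floor_add_one ((K - v : ℚ) / d)
    have h3 := Int.floor_le (((0 : ℕ) - v : ℚ) / d)
    have h4 := Int.lt_floor_add_one (((0 : ℕ) - v : ℚ) / d)
    have h5 : (K - v : ℚ) / d - ((0 : ℕ) - v : ℚ) / d = K / d := by push_cast; ring
    rw [h', abs_le]
    constructor <;> linarith
  rw [Icc_one_eq_Ioc_zero]
  have key' := (Rat.cast_le (K := ℝ)).2 key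
  push_cast at key'
  exact key'

lemma abs_card_dvd_mul_add_one_sub_le (a : ℕ) (d K : ℕ) (hd : 0 < d) :
    |(#{n ∈ Icc 1 K | d ∣ a * n + 1} : ℝ) - (if d.Coprime a then (1 : ℝ) else 0) * K / d|
      ≤ 1 := by
  by_cases hcop : d.Coprime a
  · obtain ⟨v, hv⟩ : ∃ v : ℕ, d ∣ a * v + 1 := by
      have : NeZero d := ⟨hd.ne'⟩
      refine ⟨(-(a : ZMod d)⁻¹).val, ?_⟩
      rw [← ZMod.natCast_eq_zero_iff]
      push_cast
      rw [ZMod.natCast_zmod_val, mul_neg, ZMod.coe_mul_inv_eq_one a hcop.symm]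
      ring
    have hiff : ∀ n, d ∣ a * n + 1 ↔ n ≡ v [MOD d] := by
      intro n
      have hv' : a * v + 1 ≡ 0 [MOD d] := (Nat.modEq_zero_iff_dvd).2 hv
      rw [← Nat.modEq_zero_iff_dvd]
      constructor
      · intro h
        exact Nat.ModEq.cancel_left_of_coprime hcop
          (Nat.ModEq.add_right_cancel' 1 (h.trans hv'.symm))
      · intro h
        exact ((h.mul_left a).add_right 1).trans hv'
    simp_rw [hiff]
    rw [if_pos hcop, one_mul]
    exact abs_card_modEq_sub_le d v K hd
  · have hempty : {n ∈ Icc 1 K | d ∣ a * n + 1} = ∅ := by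
      rw [filter_eq_empty_iff]
      intro n _ h
      apply hcop
      have h1 : d.gcd a ∣ a * n + 1 := (Nat.gcd_dvd_left d a).trans h
      have h2 : d.gcd a ∣ a * n := (Nat.gcd_dvd_right d a).mul_right n
      exact Nat.dvd_one.1 ((Nat.dvd_add_right h2).1 h1)
    rw [hempty, if_neg hcop]
    simp

lemma hasSum_ite_dvd_mul_inv_sq (e : ℕ) (he : 0 < e) (w : ℝ) :
    HasSum (fun d : ℕ => (if e ∣ d then w else 0) / (d : ℝ) ^ 2)
      (w / (e : ℝ) ^ 2 * ∑' d : ℕ, 1 / (d : ℝ) ^ 2) := by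
  have hinj : Function.Injective (fun k : ℕ => e * k) := fun _ _ h =>
    Nat.eq_of_mul_eq_mul_left he h
  refine (hinj.hasSum_iff ?_).1 ?_
  · intro d hd
    rw [if_neg, zero_div]
    rintro ⟨k, rfl⟩
    exact hd ⟨k, rfl⟩
  · have h := ((Real.summable_one_div_nat_pow.2 one_lt_two).hasSum).mul_left (w / (e : ℝ) ^ 2)
    refine h.congr_fun ?_
    intro k
    simp only [Function.comp_apply, dvd_mul_right, if_true]
    push_cast
    ring

/-- Dirichlet series at `2` of a function of the form `d ↦ ∑ e ∣ gcd d m, w e`. -/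
lemma tsum_div_sq_eq_of_eq_sum_divisors {m : ℕ} {w : ℕ → ℝ} {c : ℕ → ℝ}
    (h : ∀ d, c d = ∑ e ∈ m.divisors, if e ∣ d then w e else 0) :
    ∑' d : ℕ, c d / (d : ℝ) ^ 2
      = (∑ e ∈ m.divisors, w e / (e : ℝ) ^ 2) * ∑' d : ℕ, 1 / (d : ℝ) ^ 2 := by
  rw [sum_mul]
  refine HasSum.tsum_eq ?_
  simp_rw [h, sum_div]
  exact hasSum_sum fun e he => hasSum_ite_dvd_mul_inv_sq e (Nat.pos_of_mem_divisors he) (w e)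

lemma divisors_filter_dvd_eq_divisors_gcd {m : ℕ} (hm : m ≠ 0) (d : ℕ) :
    m.divisors.filter (· ∣ d) = (d.gcd m).divisors := by
  ext e
  simp only [mem_filter, Nat.mem_divisors, Nat.dvd_gcd_iff]
  have := Nat.gcd_ne_zero_right (m := d) hm
  tauto

lemma gcd_eq_sum_totient (m : ℕ) (hm : m ≠ 0) (d : ℕ) :
    (d.gcd m : ℝ) = ∑ e ∈ m.divisors, if e ∣ d then (e.totient : ℝ) else 0 := by
  rw [← sum_filter, divisors_filter_dvd_eq_divisors_gcd hm]
  exact_mod_cast (Nat.sum_totient (d.gcd m)).symm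

lemma coprime_indicator_eq_sum_moebius (m : ℕ) (hm : m ≠ 0) (d : ℕ) :
    (if d.Coprime m then (1 : ℝ) else 0)
      = ∑ e ∈ m.divisors, if e ∣ d then (ArithmeticFunction.moebius e : ℝ) else 0 := by
  rw [← sum_filter, divisors_filter_dvd_eq_divisors_gcd hm]
  have h := ArithmeticFunction.coe_mul_zeta_apply (f := ArithmeticFunction.moebius) (x := d.gcd m)
  rw [ArithmeticFunction.moebius_mul_coe_zeta, ArithmeticFunction.one_apply] at h
  exact_mod_cast h

/-- `lim_{K → ∞} (∑_{n ≤ K} σ(30n)) / (∑_{n ≤ K} σ(30n+1)) = 1595/576`. -/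
theorem stmt_7 :
    Tendsto (fun K : ℕ =>
        (∑ n ∈ Finset.Icc 1 K, sigma1 (30 * n) : ℝ) /
          (∑ n ∈ Finset.Icc 1 K, sigma1 (30 * n + 1) : ℝ))
      atTop (nhds (1595 / 576)) := by
  have hnum := tendsto_sum_sigma1_div_sq (b := 0) zero_le_one (c := fun d => (d.gcd 30 : ℝ))
    (fun d => by exact_mod_cast Nat.gcd_le_right d (by norm_num))
    (fun d K hd => abs_card_dvd_mul_sub_le 30 d K hd)
  have hden := tendsto_sum_sigma1_div_sq (b := 1) le_rfl
    (c := fun d => if d.Coprime 30 then (1 : ℝ) else 0)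
    (fun d => by split_ifs <;> norm_num)
    (fun d K hd => abs_card_dvd_mul_add_one_sub_le 30 d K hd)
  rw [tsum_div_sq_eq_of_eq_sum_divisors (gcd_eq_sum_totient 30 (by norm_num))] at hnum
  rw [tsum_div_sq_eq_of_eq_sum_divisors
    (coprime_indicator_eq_sum_moebius 30 (by norm_num))] at hden
  have hdiv : (30 : ℕ).divisors = {1, 2, 3, 5, 6, 10, 15, 30} := by rfl
  have hphi : ∑ e ∈ (30 : ℕ).divisors, (e.totient : ℝ) / (e : ℝ) ^ 2 = 1595 / 900 := by
    have h6 : Nat.totient 6 = 2 := by decide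
    have h10 : Nat.totient 10 = 4 := by decide
    have h15 : Nat.totient 15 = 8 := by decide
    have h30 : Nat.totient 30 = 8 := by decide
    have h3 : Nat.totient 3 = 2 := by decide
    have h5 : Nat.totient 5 = 4 := by decide
    rw [hdiv]
    norm_num [h3, h5, h6, h10, h15, h30]
  have hmu : ∑ e ∈ (30 : ℕ).divisors, (ArithmeticFunction.moebius e : ℝ) / (e : ℝ) ^ 2
      = 576 / 900 := by
    have h2 := ArithmeticFunction.moebius_apply_prime Nat.prime_two
    have h3 := ArithmeticFunction.moebius_apply_prime Nat.prime_three
    have h5 := ArithmeticFunction.moebius_apply_prime Nat.prime_five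
    have hmul := ArithmeticFunction.isMultiplicative_moebius
    have h6 := hmul.map_mul_of_coprime (m := 2) (n := 3) (by norm_num)
    have h10 := hmul.map_mul_of_coprime (m := 2) (n := 5) (by norm_num)
    have h15 := hmul.map_mul_of_coprime (m := 3) (n := 5) (by norm_num)
    have h30 := hmul.map_mul_of_coprime (m := 2) (n := 15) (by norm_num)
    norm_num [h2, h3, h5] at h6 h10 h15
    norm_num [h2, h15] at h30
    rw [hdiv]
    norm_num [h2, h3, h5, h6, h10, h15, h30]
  rw [hphi] at hnum
  rw [hmu] at hden
  set Z : ℝ := ∑' d : ℕ, 1 / (d : ℝ) ^ 2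
  have hZ : 0 < Z :=
    (Real.summable_one_div_nat_pow.2 one_lt_two).tsum_pos (fun _ => by positivity) 1 (by norm_num)
  have hquot := hnum.div hden (by positivity)
  have hlim : 15 * (1595 / 900 * Z) / (15 * (576 / 900 * Z)) = 1595 / 576 := by
    field_simp
  rw [hlim] at hquot
  refine hquot.congr' ?_
  filter_upwards [eventually_gt_atTop 0] with K hK
  have hK' : (K : ℝ) ^ 2 ≠ 0 := by positivity
  simp only [Pi.div_apply, add_zero]
  rw [div_div_div_cancel_right₀ hK']
end

section
/- Let k be a positive integer and let L_i(x) = a_i·x + b_i and H_j(x) = c_j·x + d_j (1 ≤ i, j ≤ k) be linear functions with integer coefficients such that a_i > 0 and c_j > 0 for all i, j, and a_i·d_j ≠ b_i·c_j for all 1 ≤ i, j ≤ k. Suppose that for every prime p there exists an integer n_p such that p divides none of the values L_1(n_p), …, L_k(n_p). Then there exist a constant c > 0 and x₀ > 0 (depending on the L_i and H_j) such that for all real x ≥ x₀, the number of positive integers n ≤ x with σ(H_j(n)) > max_{1 ≤ i ≤ k} σ(L_i(n)) for every 1 ≤ j ≤ k is at least c·x/(log x)^k. -/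
open Finset

/-- The sum-of-divisors function, evaluated on an integer via its nonnegative part:
for `x > 0` this is `σ(x) = ∑_{d ∣ x} d`. -/
def sigmaZ (x : ℤ) : ℕ := ∑ d ∈ x.toNat.divisors, d

/-- Elements of `range N` at which `q * M * m + B` is divisible by `D` are sparse when `B` is
coprime to `M`, uniformly in `M`. -/
lemma card_filter_dvd_linear_le (q M B N D : ℕ) (hq : 0 < q) (hM : Nat.Coprime B M) :
    #{m ∈ range N | D ∣ q * M * m + B} ≤ q * N / D + 1 := by
  rw [← card_range (q * N / D + 1)]
  refine card_le_card_of_injOn (fun m => q * m / D) ?_ ?_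
  · intro m hm
    simp only [coe_filter, mem_range, Set.mem_ofPred_eq] at hm
    simp only [coe_range, Set.mem_Iio, Nat.lt_succ_iff]
    exact Nat.div_le_div_right (Nat.mul_le_mul_left _ hm.1.le)
  · intro m hm m' hm' h
    simp only [coe_filter, mem_range, Set.mem_ofPred_eq] at hm hm' h
    have hcop : Nat.Coprime D M := by
      have h1 : Nat.gcd D M ∣ B :=
        (Nat.dvd_add_right ((Nat.gcd_dvd_right D M).mul_left q |>.mul_right m)).1
          ((Nat.gcd_dvd_left D M).trans hm.2)
      exact Nat.eq_one_of_dvd_coprimes hM h1 (Nat.gcd_dvd_right D M)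
    have hmod : M * (q * m) ≡ M * (q * m') [MOD D] := by
      have h2 : q * M * m + B ≡ q * M * m' + B [MOD D] :=
        ((Nat.modEq_zero_iff_dvd).2 hm.2).trans ((Nat.modEq_zero_iff_dvd).2 hm'.2).symm
      have h3 := Nat.ModEq.add_right_cancel' B h2
      convert h3 using 1 <;> ring
    have hmod' : q * m % D = q * m' % D := Nat.ModEq.cancel_left_of_coprime hcop hmod
    have : q * m = q * m' := by
      rw [← Nat.div_add_mod (q * m) D, ← Nat.div_add_mod (q * m') D, hmod', h]
    exact Nat.eq_of_mul_eq_mul_left hq this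

lemma sum_Icc_inv_sq_le_two (n : ℕ) : ∑ d ∈ Icc 1 n, ((d : ℝ) ^ 2)⁻¹ ≤ 2 := by
  rcases Nat.eq_zero_or_pos n with rfl | hn
  · simp
  suffices h : ∑ d ∈ Icc 1 n, ((d : ℝ) ^ 2)⁻¹ ≤ 2 - 1 / n from
    h.trans (sub_le_self _ (by positivity))
  induction n, hn using Nat.le_induction with
  | base => norm_num
  | succ n hn ih =>
    rw [sum_Icc_succ_top (by omega)]
    have hn' : (0 : ℝ) < n := by exact_mod_cast hn
    have : (((n + 1 : ℕ) : ℝ) ^ 2)⁻¹ ≤ 1 / n - 1 / ((n + 1 : ℕ) : ℝ) := by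
      push_cast
      rw [div_sub_div _ _ (by positivity) (by positivity), inv_eq_one_div,
        div_le_div_iff₀ (by positivity) (by positivity)]
      nlinarith
    linarith

lemma sum_divisors_div_self (n : ℕ) (hn : 0 < n) :
    ((∑ d ∈ n.divisors, d : ℕ) : ℝ) / n = ∑ d ∈ n.divisors, (d : ℝ)⁻¹ := by
  rw [← Nat.sum_div_divisors n (fun d => d), Nat.cast_sum, sum_div]
  refine sum_congr rfl fun d hd => ?_
  have hd' := Nat.dvd_of_mem_divisors hd
  have : (d : ℝ) ≠ 0 := by exact_mod_cast (Nat.pos_of_mem_divisors hd).ne'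
  have : (n : ℝ) ≠ 0 := by exact_mod_cast hn.ne'
  rw [Nat.cast_div hd' ‹_›]
  field_simp

/-- The mean of `σ(n) / n` along an arithmetic progression `q * M * m + B` with `B` coprime to `M`
is bounded in terms of `q` alone, up to a logarithmic error. -/
lemma sum_sigma_div_self_linear_le (q M B N : ℕ) (hq : 0 < q) (hM : Nat.Coprime B M) (hB : 0 < B) :
    ∑ m ∈ range N, ((∑ d ∈ (q * M * m + B).divisors, d : ℕ) : ℝ) / (q * M * m + B : ℕ) ≤
      2 * q * N + (1 + Real.log (q * M * N + B : ℕ)) := by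
  set X := q * M * N + B
  calc _ = ∑ m ∈ range N, ∑ d ∈ Icc 1 X, if d ∣ q * M * m + B then (d : ℝ)⁻¹ else 0 := by
        refine sum_congr rfl fun m hm => ?_
        rw [sum_divisors_div_self _ (by omega), ← sum_filter]
        refine sum_congr ?_ fun _ _ => rfl
        ext d
        simp only [Nat.mem_divisors, mem_filter, mem_Icc]
        constructor
        · rintro ⟨h, h0⟩
          have h1 := Nat.le_of_dvd (by omega) h
          have h2 : q * M * m ≤ q * M * N := Nat.mul_le_mul_left _ (mem_range.1 hm).le
          exact ⟨⟨Nat.pos_of_dvd_of_pos h (by omega), by omega⟩, h⟩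
        · rintro ⟨_, h⟩
          exact ⟨h, by omega⟩
    _ = ∑ d ∈ Icc 1 X, (#{m ∈ range N | d ∣ q * M * m + B} : ℝ) * (d : ℝ)⁻¹ := by
        rw [sum_comm]
        refine sum_congr rfl fun d _ => ?_
        rw [← sum_filter, sum_const, nsmul_eq_mul]
    _ ≤ ∑ d ∈ Icc 1 X, (q * N * ((d : ℝ) ^ 2)⁻¹ + (d : ℝ)⁻¹) := by
        refine sum_le_sum fun d hd => ?_
        have hd' : 0 < d := (mem_Icc.1 hd).1
        have h1 : (#{m ∈ range N | d ∣ q * M * m + B} : ℝ) ≤ q * N / d + 1 := by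
          calc _ ≤ ((q * N / d + 1 : ℕ) : ℝ) := by
                exact_mod_cast card_filter_dvd_linear_le q M B N d hq hM
            _ ≤ _ := by
                push_cast
                gcongr
                exact_mod_cast (Nat.cast_div_le (α := ℝ) (m := q * N) (n := d))
        calc _ ≤ (q * N / d + 1 : ℝ) * (d : ℝ)⁻¹ := by gcongr
          _ = _ := by ring
    _ ≤ _ := by
        rw [sum_add_distrib, ← mul_sum]
        have h1 := sum_Icc_inv_sq_le_two X
        have h2 : ∑ d ∈ Icc 1 X, (d : ℝ)⁻¹ ≤ 1 + Real.log X := by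
          have := harmonic_le_one_add_log X
          rwa [harmonic_eq_sum_Icc, Rat.cast_sum, sum_congr rfl fun d _ => by
            rw [Rat.cast_inv, Rat.cast_natCast]] at this
        have h3 : (q * N : ℝ) * ∑ d ∈ Icc 1 X, ((d : ℝ) ^ 2)⁻¹ ≤ q * N * 2 := by gcongr
        linarith

lemma eventually_one_add_log_linear_le (A B : ℕ) :
    ∀ᶠ N : ℕ in Filter.atTop, 1 + Real.log (A * N + B : ℕ) ≤ N := by
  have h1 : ∀ᶠ N : ℕ in Filter.atTop, Real.log N ≤ 1 / 2 * N := by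
    have := (Real.isLittleO_log_id_atTop.bound (c := 1 / 2) (by norm_num))
    filter_upwards [tendsto_natCast_atTop_atTop.eventually this] with N hN
    simpa using (le_abs_self _).trans hN
  have h2 : ∀ᶠ N : ℕ in Filter.atTop, 2 * (1 + Real.log (A + B + 1 : ℕ)) ≤ (N : ℝ) :=
    tendsto_natCast_atTop_atTop.eventually_ge_atTop _
  filter_upwards [h1, h2, Filter.eventually_ge_atTop 1] with N h1 h2 hN
  have hlog : Real.log (A * N + B : ℕ) ≤ Real.log (A + B + 1 : ℕ) + Real.log N := by
    rw [← Real.log_mul (by positivity) (by positivity), ← Nat.cast_mul]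
    rcases Nat.eq_zero_or_pos (A * N + B) with h0 | h0
    · rw [h0, Nat.cast_zero, Real.log_zero]
      exact Real.log_natCast_nonneg _
    · refine Real.log_le_log (by exact_mod_cast h0) ?_
      exact_mod_cast (by nlinarith : A * N + B ≤ (A + B + 1) * N)
  linarith

/-- Along an arithmetic progression, `σ(n) > T * n` fails for all but a `(2 * q + 1) / T`
proportion of the terms. -/
lemma eventually_card_sigma_gt_le (q M B : ℕ) (hq : 0 < q) (hM : Nat.Coprime B M) (hB : 0 < B)
    (T : ℕ) :
    ∀ᶠ N : ℕ in Filter.atTop,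
      T * #{m ∈ range N | T * (q * M * m + B) < ∑ d ∈ (q * M * m + B).divisors, d} ≤
        (2 * q + 1) * N := by
  filter_upwards [eventually_one_add_log_linear_le (q * M) B] with N hN
  have h := sum_sigma_div_self_linear_le q M B N hq hM hB
  have h1 : (T : ℝ) * #{m ∈ range N | T * (q * M * m + B) < ∑ d ∈ (q * M * m + B).divisors, d} ≤
      ∑ m ∈ range N, ((∑ d ∈ (q * M * m + B).divisors, d : ℕ) : ℝ) / (q * M * m + B : ℕ) := by
    rw [mul_comm, ← nsmul_eq_mul]
    refine (card_nsmul_le_sum _ _ _ fun m hm => ?_).trans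
      (sum_le_sum_of_subset_of_nonneg (filter_subset _ _) fun _ _ _ => by positivity)
    have hpos : (0 : ℝ) < (q * M * m + B : ℕ) := by exact_mod_cast (by omega)
    rw [le_div_iff₀ hpos]
    exact_mod_cast (mem_filter.1 hm).2.le
  have h2 : (T : ℝ) * #{m ∈ range N | T * (q * M * m + B) < ∑ d ∈ (q * M * m + B).divisors, d} ≤
      (2 * q + 1) * N := by linarith
  exact_mod_cast h2

lemma exists_finset_primes_sum_inv_gt (S : Finset ℕ) (C : ℝ) :
    ∃ Q : Finset ℕ, (∀ p ∈ Q, p.Prime) ∧ Disjoint Q S ∧ C < ∑ p ∈ Q, (p : ℝ)⁻¹ := by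
  by_contra! h
  refine not_summable_one_div_on_primes
    (summable_of_sum_le (c := C + ∑ p ∈ S, (p : ℝ)⁻¹) (fun n => ?_) fun u => ?_)
  · exact Set.indicator_nonneg (fun _ _ => by positivity) _
  have h1 := h ({p ∈ u | p.Prime} \ S) (fun p hp => by simp at hp; exact hp.1.2)
    sdiff_disjoint
  calc _ = ∑ p ∈ u with p.Prime, (p : ℝ)⁻¹ := by
        rw [sum_filter]
        exact sum_congr rfl fun p _ => by simp [Set.indicator_apply]
    _ ≤ ∑ p ∈ ({p ∈ u | p.Prime} \ S) ∪ S, (p : ℝ)⁻¹ := by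
        refine sum_le_sum_of_subset_of_nonneg (fun p hp => ?_) fun _ _ _ => by positivity
        by_cases hS : p ∈ S
        · exact mem_union_right _ hS
        · exact mem_union_left _ (mem_sdiff.2 ⟨hp, hS⟩)
    _ ≤ _ := by
        rw [sum_union sdiff_disjoint]
        linarith

/-- Finitely many colours can be assigned to finitely many primes outside `S` so that the
reciprocals of the primes of each colour have a large sum. -/
lemma exists_coloured_primes_sum_inv_gt {ι : Type*} [DecidableEq ι] [Inhabited ι]
    (S : Finset ℕ) (C : ℝ) (s : Finset ι) :
    ∃ (P : Finset ℕ) (χ : ℕ → ι), (∀ p ∈ P, p.Prime) ∧ Disjoint P S ∧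
      ∀ j ∈ s, C < ∑ p ∈ P with χ p = j, (p : ℝ)⁻¹ := by
  induction s using Finset.induction_on with
  | empty => exact ⟨∅, fun _ => default, by simp, by simp, by simp⟩
  | insert j s hj ih =>
    obtain ⟨P, χ, hP, hPS, hsum⟩ := ih
    obtain ⟨Q, hQ, hQS, hQsum⟩ := exists_finset_primes_sum_inv_gt (S ∪ P) C
    rw [disjoint_union_right] at hQS
    refine ⟨P ∪ Q, fun p => if p ∈ Q then j else χ p, ?_, ?_, ?_⟩
    · intro p hp
      exact (mem_union.1 hp).elim (hP p) (hQ p)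
    · exact disjoint_union_left.2 ⟨hPS, hQS.1⟩
    · intro i hi
      rcases mem_insert.1 hi with rfl | hi
      · refine hQsum.trans_le (sum_le_sum_of_subset_of_nonneg (fun p hp => ?_)
          fun _ _ _ => by positivity)
        simp [hp]
      · refine (hsum i hi).trans_le (sum_le_sum_of_subset_of_nonneg (fun p hp => ?_)
          fun _ _ _ => by positivity)
        rw [mem_filter] at hp ⊢
        exact ⟨mem_union_left _ hp.1, by
          simpa only [if_neg fun h => disjoint_left.1 hQS.2 h hp.1] using hp.2⟩

lemma mul_sum_inv_le_sum_divisors (n : ℕ) (hn : 0 < n) (P : Finset ℕ) (hP : ∀ p ∈ P, p ∣ n) :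
    (n : ℝ) * ∑ p ∈ P, (p : ℝ)⁻¹ ≤ (∑ d ∈ n.divisors, d : ℕ) := by
  have h := sum_divisors_div_self n hn
  rw [div_eq_iff (by positivity)] at h
  rw [h, mul_comm]
  gcongr
  exact fun p hp => Nat.mem_divisors.2 ⟨hP p hp, hn.ne'⟩

lemma exists_nat_dvd_linear (p : ℕ) (hp : p.Prime) (c d : ℤ) (hc : ¬ (p : ℤ) ∣ c) :
    ∃ t : ℕ, (p : ℤ) ∣ c * t + d := by
  have := Fact.mk hp
  have hc' : (c : ZMod p) ≠ 0 := by rwa [Ne, ZMod.intCast_zmod_eq_zero_iff_dvd]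
  refine ⟨(-(d : ZMod p) / c).val, ?_⟩
  rw [← ZMod.intCast_zmod_eq_zero_iff_dvd]
  push_cast
  rw [ZMod.natCast_zmod_val]
  field_simp
  ring

/-- There is a residue class `r` modulo `M` on which every `c j * n + d j` is divisible by many
primes while every `a i * n + b i` is coprime to `M`. -/
lemma exists_residue_class {k : ℕ} (hk : 0 < k) (a b c d : Fin k → ℤ) (hc : ∀ j, 0 < c j)
    (hne : ∀ i j, a i * d j ≠ b i * c j) (C : ℝ) :
    ∃ M r : ℕ, 0 < M ∧ ∀ n : ℕ, n ≡ r [MOD M] →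
      (∀ i, IsCoprime (a i * n + b i) (M : ℤ)) ∧
      ∀ j, ∃ P : Finset ℕ, (∀ p ∈ P, (p : ℤ) ∣ c j * n + d j) ∧ C < ∑ p ∈ P, (p : ℝ)⁻¹ := by
  have : Inhabited (Fin k) := ⟨⟨0, hk⟩⟩
  set K : ℤ := (∏ j, c j) * ∏ i, ∏ j, (a i * d j - b i * c j)
  have hK0 : K ≠ 0 := mul_ne_zero (prod_ne_zero_iff.2 fun j _ => (hc j).ne')
    (prod_ne_zero_iff.2 fun i _ => prod_ne_zero_iff.2 fun j _ => sub_ne_zero.2 (hne i j))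
  obtain ⟨P, χ, hP, hPS, hsum⟩ :=
    exists_coloured_primes_sum_inv_gt K.natAbs.primeFactors C (univ : Finset (Fin k))
  have hPK : ∀ p ∈ P, ¬ (p : ℤ) ∣ K := fun p hp h =>
    disjoint_left.1 hPS hp (Nat.mem_primeFactors.2
      ⟨hP p hp, Int.natCast_dvd.1 h, Int.natAbs_ne_zero.2 hK0⟩)
  have hroot : ∀ p, ∃ t : ℕ, p ∈ P → (p : ℤ) ∣ c (χ p) * t + d (χ p) := by
    intro p
    by_cases hp : p ∈ P
    · obtain ⟨t, ht⟩ := exists_nat_dvd_linear p (hP p hp) (c (χ p)) (d (χ p)) fun h =>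
        hPK p hp ((h.trans (dvd_prod_of_mem c (mem_univ _))).mul_right _)
      exact ⟨t, fun _ => ht⟩
    · exact ⟨0, fun h => absurd h hp⟩
  choose t ht using hroot
  obtain ⟨r, hr⟩ := Nat.chineseRemainderOfFinset t id P (fun p hp => (hP p hp).ne_zero)
    (fun p hp p' hp' h => (Nat.coprime_primes (hP p hp) (hP p' hp')).2 h)
  refine ⟨∏ p ∈ P, p, r, prod_pos fun p hp => (hP p hp).pos, fun n hn => ?_⟩
  have hH : ∀ p ∈ P, (p : ℤ) ∣ c (χ p) * n + d (χ p) := by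
    intro p hp
    have h1 : n ≡ t p [MOD p] := (hn.of_dvd (dvd_prod_of_mem _ hp)).trans (hr p hp)
    have h2 : (c (χ p) * n + d (χ p) : ℤ) ≡ c (χ p) * t p + d (χ p) [ZMOD p] :=
      ((Int.natCast_modEq_iff.2 h1).mul_left _).add_right _
    exact (h2.dvd_iff).2 (ht p hp)
  constructor
  · intro i
    push_cast
    refine IsCoprime.prod_right fun p hp => ?_
    refine ((Nat.prime_iff_prime_int.1 (hP p hp)).coprime_iff_not_dvd.2 fun h => ?_).symm
    have h1 : (p : ℤ) ∣ a i * d (χ p) - b i * c (χ p) := by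
      have hcomb : a i * d (χ p) - b i * c (χ p) =
          a i * (c (χ p) * n + d (χ p)) - c (χ p) * (a i * n + b i) := by ring
      exact hcomb ▸ dvd_sub ((hH p hp).mul_left (a i)) (h.mul_left (c (χ p)))
    refine hPK p hp (((h1.trans ?_).trans (dvd_prod_of_mem _ (mem_univ i))).mul_left _)
    exact dvd_prod_of_mem (fun j => a i * d j - b i * c j) (mem_univ _)
  · intro j
    refine ⟨{p ∈ P | χ p = j}, fun p hp => ?_, hsum j (mem_univ j)⟩
    rw [mem_filter] at hp
    exact hp.2 ▸ hH p hp.1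

/-- Let `L i (x) = a i * x + b i` and `H j (x) = c j * x + d j` (`1 ≤ i, j ≤ k`) be linear
functions with integer coefficients, `a i, c j > 0`, `a i * d j ≠ b i * c j` for all `i, j`,
and such that for every prime `p` some integer `n_p` makes `p` divide none of the `L i (n_p)`.
Then there are `≫ x / (log x)^k` positive integers `n ≤ x` with
`σ(H j (n)) > max_i σ(L i (n))` for every `j`. -/
theorem stmt_12 (k : ℕ) (hk : 0 < k) (a b c d : Fin k → ℤ)
    (ha : ∀ i, 0 < a i) (hc : ∀ j, 0 < c j)
    (hne : ∀ i j, a i * d j ≠ b i * c j)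
    (hfix : ∀ p : ℕ, p.Prime → ∃ n : ℤ, ∀ i, ¬ (p : ℤ) ∣ (a i * n + b i)) :
    ∃ C : ℝ, 0 < C ∧ ∃ x₀ : ℝ, 0 < x₀ ∧ ∀ x : ℝ, x₀ ≤ x →
      C * x / (Real.log x) ^ k ≤
        (((Finset.Icc 1 ⌊x⌋₊).filter fun n : ℕ => ∀ j i,
          sigmaZ (a i * (n : ℤ) + b i) < sigmaZ (c j * (n : ℤ) + d j)).card : ℝ) := by
  set E : ℕ := ∑ i, ((a i).natAbs + (b i).natAbs + (c i).natAbs + (d i).natAbs)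
  have hbound (i : Fin k) :
      (a i).natAbs + (b i).natAbs + (c i).natAbs + (d i).natAbs ≤ E :=
    single_le_sum (f := fun i => (a i).natAbs + (b i).natAbs + (c i).natAbs + (d i).natAbs)
      (fun _ _ => Nat.zero_le _) (mem_univ i)
  set T : ℕ := 2 * k * (2 * E + 1) with hT
  obtain ⟨M, r₀, hM, hclass⟩ := exists_residue_class hk a b c d hc hne (4 * E * T : ℕ)
  set r : ℕ := r₀ + M * (2 * E + 1) with hr
  have hrE : 2 * E + 1 ≤ r := by nlinarith
  have hmod (m : ℕ) : r + M * m ≡ r₀ [MOD M] := by simp [hr, Nat.ModEq]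
  have hLpos (n : ℕ) (hn : r ≤ n) (i : Fin k) : 0 < a i * n + b i := by
    have := hbound i
    have := ha i
    have : (n : ℤ) ≤ a i * n := le_mul_of_one_le_left (by positivity) (ha i)
    omega
  set B : Fin k → ℕ := fun i => (a i * r + b i).toNat with hB
  have hBcast (i : Fin k) : (B i : ℤ) = a i * r + b i :=
    Int.toNat_of_nonneg (hLpos r le_rfl i).le
  have hacast (i : Fin k) : ((a i).natAbs : ℤ) = a i := Int.natAbs_of_nonneg (ha i).le
  have hL (i : Fin k) (m : ℕ) :
      a i * (r + M * m : ℕ) + b i = ((a i).natAbs * M * m + B i : ℕ) := by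
    push_cast
    rw [hBcast, Int.abs_eq_natAbs, hacast]
    ring
  have hev : ∀ᶠ N : ℕ in Filter.atTop, ∀ i, T * #{m ∈ range N |
      T * ((a i).natAbs * M * m + B i) < ∑ e ∈ ((a i).natAbs * M * m + B i).divisors, e} ≤
        (2 * (a i).natAbs + 1) * N := by
    refine Filter.eventually_all.2 fun i => ?_
    refine eventually_card_sigma_gt_le _ M (B i) (Int.natAbs_pos.2 (ha i).ne') ?_ ?_ T
    · rw [← Nat.isCoprime_iff_coprime, hBcast]
      exact (hclass r (by simpa using hmod 0)).1 i
    · have := hLpos r le_rfl i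
      have := hBcast i
      omega
  obtain ⟨N₀, hN₀⟩ := Filter.eventually_atTop.1 hev
  have hgood (m : ℕ) (hm : ∀ i, ¬ T * ((a i).natAbs * M * m + B i) <
      ∑ e ∈ ((a i).natAbs * M * m + B i).divisors, e) (j i : Fin k) :
      sigmaZ (a i * (r + M * m : ℕ) + b i) < sigmaZ (c j * (r + M * m : ℕ) + d j) := by
    obtain ⟨P, hP, hPsum⟩ := (hclass _ (hmod m)).2 j
    have hmi := hm i
    set n := r + M * m with hn
    have hnE : 2 * E + 1 ≤ n := by omega
    have hHn : (n : ℤ) ≤ 2 * (c j * n + d j) := by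
      have := hbound j
      have : (n : ℤ) ≤ c j * n := le_mul_of_one_le_left (by positivity) (hc j)
      omega
    have hLn : a i * n + b i ≤ 2 * E * n := by
      have := hbound i
      have h1 : a i * n ≤ E * n := by gcongr; omega
      have h2 : b i ≤ E * n := by
        have : (E : ℤ) ≤ E * n := le_mul_of_one_le_right (by positivity) (by omega)
        omega
      linarith
    obtain ⟨h, hh⟩ := Int.eq_ofNat_of_zero_le (by omega : 0 ≤ c j * n + d j)
    rw [hh] at hHn hP ⊢
    have hL' := hL i m
    rw [hL'] at hLn ⊢
    set l := (a i).natAbs * M * m + B i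
    simp only [sigmaZ, Int.toNat_natCast]
    norm_cast at hHn hLn
    have hh0 : 0 < h := by omega
    have hsig := mul_sum_inv_le_sum_divisors h hh0 P fun p hp => Int.natCast_dvd_natCast.1 (hP p hp)
    have hlt : (h : ℝ) * (4 * E * T : ℕ) < (∑ e ∈ h.divisors, e : ℕ) :=
      lt_of_lt_of_le (by gcongr) hsig
    norm_cast at hlt
    push Not at hmi
    calc _ ≤ T * l := hmi
      _ ≤ T * (2 * E * n) := by gcongr
      _ ≤ T * (2 * E * (2 * h)) := by gcongr
      _ = h * (4 * E * T) := by ring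
      _ < _ := hlt
  have hcount (N : ℕ) (hN : N₀ ≤ N) : N ≤ 2 * #{m ∈ range N | ∀ i,
      ¬ T * ((a i).natAbs * M * m + B i) <
        ∑ e ∈ ((a i).natAbs * M * m + B i).divisors, e} := by
    set bad : Fin k → Finset ℕ := fun i => {m ∈ range N | T * ((a i).natAbs * M * m + B i) <
        ∑ e ∈ ((a i).natAbs * M * m + B i).divisors, e} with hbad
    have hbadle (i : Fin k) : 2 * k * #(bad i) ≤ N := by
      have h1 := hN₀ N hN i
      have h2 : (2 * (a i).natAbs + 1) * N ≤ (2 * E + 1) * N := by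
        have := hbound i
        gcongr
        omega
      refine le_of_mul_le_mul_left (a := 2 * E + 1) ?_ (by omega)
      calc _ = T * #(bad i) := by rw [hT]; ring
        _ ≤ _ := h1.trans h2
    have hunion : 2 * #(univ.biUnion bad) ≤ N := by
      refine le_of_mul_le_mul_left (a := k) ?_ hk
      calc k * (2 * #(univ.biUnion bad)) ≤ k * (2 * ∑ i, #(bad i)) := by
            gcongr
            exact card_biUnion_le
        _ = ∑ i, 2 * k * #(bad i) := by rw [← mul_sum]; ring
        _ ≤ ∑ _i : Fin k, N := sum_le_sum fun i _ => hbadle i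
        _ = k * N := by simp
    have hcover : range N ⊆ univ.biUnion bad ∪ {m ∈ range N | ∀ i,
        ¬ T * ((a i).natAbs * M * m + B i) <
          ∑ e ∈ ((a i).natAbs * M * m + B i).divisors, e} := by
      intro m hm
      simp only [mem_union, mem_biUnion, mem_univ, true_and, hbad, mem_filter, hm]
      exact (Classical.em _).imp_right not_exists.1
    have := (card_le_card hcover).trans (card_union_le _ _)
    rw [card_range] at this
    omega
  have hM' : (0 : ℝ) < M := by exact_mod_cast hM
  refine ⟨1 / (4 * M), by positivity, 2 * M * (r + 2 + N₀) + 3, by positivity, fun x hx => ?_⟩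
  have hx3 : 3 ≤ x := le_trans (by linarith [show (0 : ℝ) ≤ 2 * M * (r + 2 + N₀) by positivity]) hx
  have hlog : 1 ≤ Real.log x := by
    rw [Real.le_log_iff_exp_le (by linarith)]
    linarith [Real.exp_one_lt_d9]
  set N : ℕ := ⌊x⌋₊ / M - r with hN
  have hNx : x / (2 * M) ≤ N ∧ (N₀ : ℝ) ≤ N := by
    have h1 : x < ⌊x⌋₊ + 1 := Nat.lt_floor_add_one x
    have h2 : ⌊x⌋₊ + 1 ≤ M * (N + r + 1) := by
      have : ⌊x⌋₊ < M * (⌊x⌋₊ / M + 1) := Nat.lt_mul_div_succ _ hM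
      exact this.trans_le (Nat.mul_le_mul_left _ (by omega))
    have h3 : x ≤ M * (N + r + 1) := h1.le.trans (by exact_mod_cast h2)
    have h4 : x / M ≤ N + r + 1 := by rw [div_le_iff₀' hM']; exact h3
    have h5 : r + 2 + N₀ ≤ x / (2 * M) := by
      rw [le_div_iff₀' (by positivity)]
      linarith
    have h6 : x / M = 2 * (x / (2 * M)) := by field_simp
    have : (0 : ℝ) ≤ r := by positivity
    have : (0 : ℝ) ≤ N₀ := by positivity
    constructor <;> linarith
  have hcard : #{m ∈ range N | ∀ i, ¬ T * ((a i).natAbs * M * m + B i) <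
        ∑ e ∈ ((a i).natAbs * M * m + B i).divisors, e} ≤
      #{n ∈ Icc 1 ⌊x⌋₊ | ∀ j i,
        sigmaZ (a i * ((n : ℕ) : ℤ) + b i) < sigmaZ (c j * (n : ℤ) + d j)} := by
    refine card_le_card_of_injOn (fun m => r + M * m) ?_ ?_
    · intro m hm
      rw [mem_coe, mem_filter, mem_range] at hm
      rw [mem_coe, mem_filter, mem_Icc]
      refine ⟨⟨hrE.trans' (by omega) |>.trans (Nat.le_add_right _ _), ?_⟩, hgood m hm.2⟩
      calc r + M * m ≤ M * r + M * m := by gcongr; exact Nat.le_mul_of_pos_left r hM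
        _ = M * (r + m) := by ring
        _ ≤ M * (⌊x⌋₊ / M) := by gcongr; omega
        _ ≤ ⌊x⌋₊ := Nat.mul_div_le _ _
    · intro m _ m' _ h
      simpa [hM.ne'] using h
  have hfinal : (N : ℝ) ≤ 2 * (#{n ∈ Icc 1 ⌊x⌋₊ | ∀ j i,
      sigmaZ (a i * ((n : ℕ) : ℤ) + b i) < sigmaZ (c j * (n : ℤ) + d j)} : ℕ) := by
    exact_mod_cast (hcount N (by exact_mod_cast hNx.2)).trans (Nat.mul_le_mul_left 2 hcard)
  calc 1 / (4 * M) * x / Real.log x ^ k ≤ 1 / (4 * M) * x :=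
        div_le_self (by positivity) (one_le_pow₀ hlog)
    _ = x / (2 * M) / 2 := by field_simp; ring
    _ ≤ _ := by linarith [hNx.1]
end

section
/- Let f be a polynomial with integer coefficients of degree n ≥ 1, with leading coefficient a_n, such that f(m) > 0 for all positive integers m. For each positive integer d let N(d) denote the number of residues r modulo d (not counting multiplicities) with f(r) ≡ 0 (mod d). Then the series β = ∑_{d=1}^{∞} N(d)/d² converges, and ∑_{m ≤ x} σ(f(m)) = (β·a_n/(n+1))·x^{n+1} + O(x^n·(log x)^n) as x → ∞; that is, there exist C > 0 and x₀ such that for all x ≥ x₀, |∑_{m ≤ x} σ(f(m)) − (β·a_n/(n+1))·x^{n+1}| ≤ C·x^n·(log x)^n. -/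
open Finset Polynomial

/-- `N(d)`: the number of residues `r` modulo `d` with `f(r) ≡ 0 (mod d)`. -/
def rootCount (f : Polynomial ℤ) (d : ℕ) : ℕ :=
  ((Finset.range d).filter fun r : ℕ => (d : ℤ) ∣ f.eval (r : ℤ)).card

lemma dvd_eval_iff_of_modEq (f : ℤ[X]) {d a b : ℕ} (h : a ≡ b [MOD d]) :
    (d : ℤ) ∣ f.eval (a : ℤ) ↔ (d : ℤ) ∣ f.eval (b : ℤ) := by
  have h1 : (d : ℤ) ∣ (a : ℤ) - b := (Nat.modEq_iff_dvd.1 h.symm)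
  exact (dvd_iff_dvd_of_dvd_sub (h1.trans (sub_dvd_eval_sub _ _ f)))

lemma periodic_dvd_eval (f : ℤ[X]) (d : ℕ) :
    Function.Periodic (fun r : ℕ => (d : ℤ) ∣ f.eval (r : ℤ)) d := fun r =>
  propext (dvd_eval_iff_of_modEq f (by simp [Nat.ModEq]))

lemma rootCount_eq_count (f : ℤ[X]) (d : ℕ) :
    rootCount f d = Nat.count (fun r : ℕ => (d : ℤ) ∣ f.eval (r : ℤ)) d := by
  rw [Nat.count_eq_card_filter_range, rootCount]

lemma rootCount_le (f : ℤ[X]) (d : ℕ) : rootCount f d ≤ d := by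
  simpa [rootCount] using Finset.card_filter_le (Finset.range d) (fun r : ℕ => (d : ℤ) ∣ f.eval (r : ℤ))

lemma rootCount_one (f : ℤ[X]) : rootCount f 1 = 1 := by
  simp [rootCount]

lemma rootCount_mul_of_coprime (f : ℤ[X]) {m n : ℕ} (h : m.Coprime n) :
    rootCount f (m * n) = rootCount f m * rootCount f n := by
  rcases Nat.eq_zero_or_pos m with rfl | hm
  · simp [rootCount]
  rcases Nat.eq_zero_or_pos n with rfl | hn
  · simp [rootCount]
  rw [rootCount, rootCount, rootCount, ← Finset.card_product]
  refine Finset.card_bij (fun r _ => (r % m, r % n)) ?_ ?_ ?_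
  · intro r hr
    simp only [Finset.mem_filter, Finset.mem_range, Finset.mem_product] at hr ⊢
    refine ⟨⟨Nat.mod_lt _ hm, ?_⟩, Nat.mod_lt _ hn, ?_⟩
    · rw [dvd_eval_iff_of_modEq f (Nat.mod_modEq r m)]
      exact dvd_trans (by push_cast; exact dvd_mul_right _ _) hr.2
    · rw [dvd_eval_iff_of_modEq f (Nat.mod_modEq r n)]
      exact dvd_trans (by push_cast; exact dvd_mul_left _ _) hr.2
  · intro a ha b hb hab
    simp only [Finset.mem_filter, Finset.mem_range, Prod.mk.injEq] at ha hb hab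
    exact Nat.ModEq.eq_of_lt_of_lt ((Nat.modEq_and_modEq_iff_modEq_mul h).1 hab) ha.1 hb.1
  · rintro ⟨a, b⟩ hab
    simp only [Finset.mem_filter, Finset.mem_range, Finset.mem_product] at hab
    obtain ⟨⟨ha, ha'⟩, hb, hb'⟩ := hab
    set k := Nat.chineseRemainder h a b
    refine ⟨k, ?_, ?_⟩
    · simp only [Finset.mem_filter, Finset.mem_range]
      refine ⟨Nat.chineseRemainder_lt_mul h a b hm.ne' hn.ne', ?_⟩
      push_cast
      refine IsCoprime.mul_dvd (Nat.isCoprime_iff_coprime.2 h) ?_ ?_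
      · exact (dvd_eval_iff_of_modEq f k.2.1).2 ha'
      · exact (dvd_eval_iff_of_modEq f k.2.2).2 hb'
    · exact Prod.ext (Nat.mod_eq_of_modEq k.2.1 ha) (Nat.mod_eq_of_modEq k.2.2 hb)

lemma count_mul_add_of_periodic (P : ℕ → Prop) [DecidablePred P] {a : ℕ}
    (hP : Function.Periodic P a) (q r : ℕ) :
    Nat.count P (a * q + r) = q * Nat.count P a + Nat.count P r := by
  have shift : ∀ t, Nat.count P (a + t) = Nat.count P a + Nat.count P t := by
    intro t
    rw [Nat.count_add]
    congr 1
    have : (fun k => P (a + k)) = P := by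
      funext k
      rw [add_comm]
      exact hP k
    simp only [this]
  induction q with
  | zero => simp
  | succ q ih =>
    rw [show a * (q + 1) + r = a + (a * q + r) by ring, shift, ih]
    ring

lemma abs_count_sub_le_of_periodic (P : ℕ → Prop) [DecidablePred P] {a : ℕ} (ha : 0 < a)
    (hP : Function.Periodic P a) (t : ℕ) :
    |(Nat.count P t : ℝ) - (Nat.count P a : ℝ) / a * t| ≤ Nat.count P a := by
  have h := count_mul_add_of_periodic P hP (t / a) (t % a)
  rw [Nat.div_add_mod] at h
  have h1 : Nat.count P (t % a) ≤ Nat.count P a := Nat.count_monotone P (Nat.mod_lt _ ha).le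
  have h2 : (t : ℝ) = a * (t / a : ℕ) + (t % a : ℕ) := by
    exact_mod_cast (Nat.div_add_mod t a).symm
  have ha' : (0 : ℝ) < a := by exact_mod_cast ha
  have h3 : ((t % a : ℕ) : ℝ) ≤ a := by exact_mod_cast (Nat.mod_lt _ ha).le
  have h4 : (Nat.count P (t % a) : ℝ) ≤ Nat.count P a := by exact_mod_cast h1
  have h5 : (Nat.count P t : ℝ) - (Nat.count P a : ℝ) / a * t =
      Nat.count P (t % a) - Nat.count P a * ((t % a : ℕ) / a : ℝ) := by
    rw [h, h2]
    push_cast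
    field_simp
    ring
  have h6 : ((t % a : ℕ) / a : ℝ) ≤ 1 := (div_le_one ha').2 h3
  have h7 : (0 : ℝ) ≤ ((t % a : ℕ) / a : ℝ) := by positivity
  have h8 : (0 : ℝ) ≤ Nat.count P (t % a) := by positivity
  have h9 : (0 : ℝ) ≤ Nat.count P a := by positivity
  rw [h5, abs_le]
  constructor <;> nlinarith [mul_le_mul_of_nonneg_left h6 h9, mul_nonneg h9 h7]

lemma card_filter_range_mul (f : ℤ[X]) (d q : ℕ) :
    ((Finset.range (d * q)).filter fun r : ℕ => (d : ℤ) ∣ f.eval (r : ℤ)).card =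
      q * rootCount f d := by
  rw [← Nat.count_eq_card_filter_range, rootCount_eq_count]
  simpa using count_mul_add_of_periodic _ (periodic_dvd_eval f d) q 0

/-- The partial sums `∑ N(p^k)/p^k` of the local series of `f` at `p`; in the limit this is the
expected `p`-adic valuation of `f` at a random `p`-adic integer. -/
noncomputable def localSum (f : ℤ[X]) (p K : ℕ) : ℝ :=
  ∑ k ∈ Finset.Icc 1 K, (rootCount f (p ^ k) : ℝ) / (p : ℝ) ^ k

lemma card_pow_dvd_mul_le {p : ℕ} (hp : p.Prime) (K : ℕ) (a b : ℤ) :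
    ((Finset.Icc 1 K).filter fun k => (p : ℤ) ^ k ∣ a * b).card ≤
      ((Finset.Icc 1 K).filter fun k => (p : ℤ) ^ k ∣ a).card +
      ((Finset.Icc 1 K).filter fun k => (p : ℤ) ^ k ∣ b).card := by
  have : Fact p.Prime := ⟨hp⟩
  by_cases ha : a = 0
  · simp [ha]
  by_cases hb : b = 0
  · simp [hb]
  have key : ∀ c : ℤ, c ≠ 0 → ((Finset.Icc 1 K).filter fun k => (p : ℤ) ^ k ∣ c).card =
      min K (padicValInt p c) := by
    intro c hc
    have : ((Finset.Icc 1 K).filter fun k => (p : ℤ) ^ k ∣ c) =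
        Finset.Icc 1 (min K (padicValInt p c)) := by
      ext k
      simp only [Finset.mem_filter, Finset.mem_Icc, padicValInt_dvd_iff, hc, false_or]
      omega
    simp [this]
  rw [key _ ha, key _ hb, key _ (mul_ne_zero ha hb), padicValInt.mul ha hb]
  omega

lemma localSum_eq (f : ℤ[X]) {p : ℕ} (hp : p.Prime) (K : ℕ) :
    localSum f p K = (∑ x ∈ Finset.range (p ^ K),
      (((Finset.Icc 1 K).filter fun k => (p : ℤ) ^ k ∣ f.eval (x : ℤ)).card : ℝ)) /
        (p : ℝ) ^ K := by
  have hp0 : (p : ℝ) ≠ 0 := by exact_mod_cast hp.ne_zero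
  have h1 : (∑ x ∈ Finset.range (p ^ K),
      ((Finset.Icc 1 K).filter fun k => (p : ℤ) ^ k ∣ f.eval (x : ℤ)).card) =
      ∑ k ∈ Finset.Icc 1 K, p ^ (K - k) * rootCount f (p ^ k) := by
    simp only [Finset.card_filter]
    rw [Finset.sum_comm]
    refine Finset.sum_congr rfl fun k hk => ?_
    rw [← card_filter_range_mul, ← pow_add, Nat.add_sub_cancel' (Finset.mem_Icc.1 hk).2,
      Finset.card_filter]
    push_cast
    rfl
  have h2 := congrArg (Nat.cast (R := ℝ)) h1
  push_cast at h2
  rw [h2, localSum, Finset.sum_div]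
  refine Finset.sum_congr rfl fun k hk => ?_
  have : (p : ℝ) ^ K = (p : ℝ) ^ (K - k) * (p : ℝ) ^ k := by
    rw [← pow_add, Nat.sub_add_cancel (Finset.mem_Icc.1 hk).2]
  rw [this]
  field_simp

lemma localSum_mul_le (f g : ℤ[X]) {p : ℕ} (hp : p.Prime) (K : ℕ) :
    localSum (f * g) p K ≤ localSum f p K + localSum g p K := by
  rw [localSum_eq _ hp, localSum_eq _ hp, localSum_eq _ hp, ← add_div, ← Finset.sum_add_distrib]
  gcongr with x hx
  rw [eval_mul]
  exact_mod_cast card_pow_dvd_mul_le hp K _ _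

lemma localSum_le_of_rootCount_le (f : ℤ[X]) {p : ℕ} (hp : p.Prime) {B : ℝ}
    (hB : ∀ k, 1 ≤ k → (rootCount f (p ^ k) : ℝ) ≤ B) (K : ℕ) :
    localSum f p K ≤ B / ((p : ℝ) - 1) := by
  have hp1 : (1 : ℝ) < p := by exact_mod_cast hp.one_lt
  have hB0 : 0 ≤ B := le_trans (by positivity) (hB 1 le_rfl)
  have geom : ∀ K : ℕ, ∑ k ∈ Finset.Icc 1 K, 1 / (p : ℝ) ^ k = (1 - 1 / (p : ℝ) ^ K) / (p - 1) := by
    intro K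
    have h3 : (p : ℝ) - 1 ≠ 0 := by linarith
    have h4 : (p : ℝ) ≠ 0 := by linarith
    induction K with
    | zero => simp
    | succ K ih =>
      rw [Finset.sum_Icc_succ_top (by omega), ih]
      field_simp
      ring
  calc localSum f p K ≤ ∑ k ∈ Finset.Icc 1 K, B * (1 / (p : ℝ) ^ k) := by
        refine Finset.sum_le_sum fun k hk => ?_
        rw [mul_one_div]
        gcongr
        exact hB k (Finset.mem_Icc.1 hk).1
    _ = B * ((1 - 1 / (p : ℝ) ^ K) / (p - 1)) := by rw [← Finset.mul_sum, geom]
    _ ≤ B * (1 / (p - 1)) := by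
        have : (0 : ℝ) ≤ 1 / (p : ℝ) ^ K := by positivity
        have : (0 : ℝ) ≤ p - 1 := by linarith
        gcongr
        linarith
    _ = B / ((p : ℝ) - 1) := by ring

lemma exists_bezout_derivative_of_irreducible {g : ℤ[X]} (hg : Irreducible g)
    (hdeg : g.natDegree ≠ 0) :
    ∃ (u w : ℤ[X]) (R : ℤ), R ≠ 0 ∧ u * g + w * derivative g = C R := by
  have hirr : Irreducible (g.map (Int.castRingHom ℚ)) :=
    (IsPrimitive.Int.irreducible_iff_irreducible_map_cast (hg.isPrimitive hdeg)).1 hg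
  obtain ⟨a, b, hab⟩ := hirr.separable
  have clear : ∀ q : ℚ[X], ∃ (c : ℤ) (Q : ℤ[X]), c ≠ 0 ∧
      Q.map (Int.castRingHom ℚ) = C (c : ℚ) * q := by
    intro q
    obtain ⟨c, hc, h⟩ := IsLocalization.integerNormalization_spec (nonZeroDivisors ℤ) q
    refine ⟨c, IsLocalization.integerNormalization (nonZeroDivisors ℤ) q,
      nonZeroDivisors.ne_zero hc, ?_⟩
    rw [← smul_eq_C_mul, Int.cast_smul_eq_zsmul]
    exact h
  obtain ⟨c, A, hc, hA⟩ := clear a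
  obtain ⟨e, B, he, hB⟩ := clear b
  refine ⟨C e * A, C c * B, c * e, mul_ne_zero hc he, ?_⟩
  apply Polynomial.map_injective (Int.castRingHom ℚ) Int.cast_injective
  rw [derivative_map] at hab
  simp only [Polynomial.map_add, Polynomial.map_mul, hA, hB, map_C, map_mul, Int.coe_castRingHom]
  linear_combination (C (c : ℚ) * C (e : ℚ)) * hab

/-- A quantitative uniqueness in Hensel's lemma: roots modulo `p ^ k` that agree modulo
`p ^ (ρ + 1)` agree modulo `p ^ (k - ρ)` when the derivative has valuation at most `ρ`. -/
lemma pow_dvd_sub_of_pow_dvd_eval {g u w : ℤ[X]} {R : ℤ} (hR : u * g + w * derivative g = C R)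
    {p : ℕ} (hp : p.Prime) {ρ k : ℕ} (hρ : ¬ (p : ℤ) ^ (ρ + 1) ∣ R) (hk : ρ + 1 ≤ k) {x y : ℤ}
    (hx : (p : ℤ) ^ k ∣ g.eval x) (hy : (p : ℤ) ^ k ∣ g.eval y) (hxy : (p : ℤ) ^ (ρ + 1) ∣ y - x) :
    (p : ℤ) ^ (k - ρ) ∣ y - x := by
  obtain ⟨z, hz⟩ := binomExpansion g x (y - x)
  rw [add_sub_cancel] at hz
  have h1 : ¬ (p : ℤ) ^ (ρ + 1) ∣ (derivative g).eval x := by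
    intro h
    apply hρ
    have := congrArg (eval x) hR
    simp only [eval_add, eval_mul, eval_C] at this
    rw [← this]
    exact dvd_add (Dvd.dvd.mul_left ((pow_dvd_pow _ hk).trans hx) _) (Dvd.dvd.mul_left h _)
  have h2 : ¬ (p : ℤ) ^ (ρ + 1) ∣ (derivative g).eval x + z * (y - x) := by
    intro h
    exact h1 ((dvd_add_left (Dvd.dvd.mul_left hxy _)).1 h)
  have h3 : (p : ℤ) ^ k ∣ (y - x) * ((derivative g).eval x + z * (y - x)) := by
    have : (y - x) * ((derivative g).eval x + z * (y - x)) = g.eval y - g.eval x := by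
      rw [hz]; ring
    rw [this]
    exact dvd_sub hy hx
  have : Fact p.Prime := ⟨hp⟩
  rw [padicValInt_dvd_iff, not_or] at h2
  rw [padicValInt_dvd_iff] at h3 ⊢
  rcases eq_or_ne (y - x) 0 with h0 | h0
  · exact Or.inl h0
  rw [padicValInt.mul h0 h2.1] at h3
  have := h3.resolve_left (mul_ne_zero h0 h2.1)
  omega

lemma rootCount_pow_le {g u w : ℤ[X]} {R : ℤ} (hR : u * g + w * derivative g = C R)
    {p : ℕ} (hp : p.Prime) {ρ k : ℕ} (hρ : ¬ (p : ℤ) ^ (ρ + 1) ∣ R) (hk : ρ + 1 ≤ k) :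
    rootCount g (p ^ k) ≤ p ^ ρ * rootCount g (p ^ (ρ + 1)) := by
  have hpow : 0 < p ^ (ρ + 1) := pow_pos hp.pos _
  refine Finset.card_le_mul_card_image_of_maps_to (f := fun r => r % p ^ (ρ + 1)) ?_ _ ?_
  · intro r hr
    simp only [Finset.mem_filter, Finset.mem_range] at hr ⊢
    refine ⟨Nat.mod_lt _ hpow, ?_⟩
    rw [dvd_eval_iff_of_modEq g (Nat.mod_modEq r _)]
    refine dvd_trans ?_ hr.2
    exact_mod_cast pow_dvd_pow p hk
  · intro b _
    rcases Finset.eq_empty_or_nonempty (((Finset.range (p ^ k)).filter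
      fun r : ℕ => ((p ^ k : ℕ) : ℤ) ∣ g.eval (r : ℤ)).filter
        fun r => r % p ^ (ρ + 1) = b) with h | ⟨x, hx⟩
    · rw [h]
      simp
    simp only [Finset.mem_filter, Finset.mem_range] at hx
    have hcard : ((Finset.range (p ^ k)).filter fun r => r ≡ x [MOD p ^ (k - ρ)]).card = p ^ ρ := by
      have h1 : p ^ k = p ^ (k - ρ) * p ^ ρ := by
        rw [← pow_add, Nat.sub_add_cancel (by omega)]
      rw [← Nat.count_eq_card_filter_range, Nat.count_modEq_card _ (pow_pos hp.pos _), h1]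
      simp [pow_pos hp.pos]
    rw [← hcard]
    refine Finset.card_le_card fun y hy => ?_
    simp only [Finset.mem_filter, Finset.mem_range] at hy ⊢
    refine ⟨hy.1.1, Nat.ModEq.symm (Nat.modEq_iff_dvd.2 ?_)⟩
    push_cast
    refine pow_dvd_sub_of_pow_dvd_eval hR hp hρ hk (by exact_mod_cast hx.1.2)
      (by exact_mod_cast hy.1.2) ?_
    have : x ≡ y [MOD p ^ (ρ + 1)] := hx.2.trans hy.2.symm
    exact_mod_cast Nat.modEq_iff_dvd.1 this

lemma rootCount_prime_le {g : ℤ[X]} {p : ℕ} (hp : p.Prime) (hlc : ¬ (p : ℤ) ∣ g.leadingCoeff) :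
    rootCount g p ≤ g.natDegree := by
  have : Fact p.Prime := ⟨hp⟩
  set G := g.map (Int.castRingHom (ZMod p)) with hG
  have hG0 : G ≠ 0 := by
    intro h
    apply hlc
    have := congrArg (fun q => coeff q g.natDegree) h
    simp only [hG, coeff_map, coeff_zero, eq_intCast] at this
    exact (ZMod.intCast_zmod_eq_zero_iff_dvd _ _).1 this
  calc rootCount g p ≤ G.roots.toFinset.card := by
        refine Finset.card_le_card_of_injOn (fun r : ℕ => (r : ZMod p)) ?_ ?_
        · intro r hr
          simp only [Finset.coe_filter, Finset.mem_range, Set.mem_ofPred_eq] at hr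
          simp only [Finset.mem_coe, Multiset.mem_toFinset, mem_roots hG0, IsRoot]
          have := (ZMod.intCast_zmod_eq_zero_iff_dvd _ p).2 hr.2
          rw [hG, ← Int.cast_natCast, ← eq_intCast (Int.castRingHom (ZMod p)), eval_map_apply,
            eq_intCast, this]
        · intro a ha b hb hab
          simp only [Finset.coe_filter, Finset.mem_range, Set.mem_ofPred_eq] at ha hb
          exact Nat.ModEq.eq_of_lt_of_lt ((ZMod.natCast_eq_natCast_iff _ _ _).1 hab) ha.1 hb.1
    _ ≤ Multiset.card G.roots := Multiset.toFinset_card_le _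
    _ ≤ G.natDegree := card_roots' _
    _ ≤ g.natDegree := natDegree_map_le

/-- The local behaviour of root counts that drives the Euler product estimate. -/
structure LocallyTame (f : ℤ[X]) : Prop where
  bounded : ∀ p : ℕ, p.Prime → ∃ B : ℝ, ∀ K, localSum f p K ≤ B
  eventually_le : ∃ p₀ : ℕ, ∀ p : ℕ, p.Prime → p₀ ≤ p → ∀ K,
    localSum f p K ≤ f.natDegree / ((p : ℝ) - 1)

lemma LocallyTame.of_rootCount_le {f : ℤ[X]}
    (h₁ : ∀ p : ℕ, p.Prime → ∃ B : ℕ, ∀ k, 1 ≤ k → rootCount f (p ^ k) ≤ B)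
    (h₂ : ∃ p₀ : ℕ, ∀ p : ℕ, p.Prime → p₀ ≤ p → ∀ k, 1 ≤ k →
      rootCount f (p ^ k) ≤ f.natDegree) : LocallyTame f := by
  refine ⟨fun p hp => ?_, ?_⟩
  · obtain ⟨B, hB⟩ := h₁ p hp
    exact ⟨_, localSum_le_of_rootCount_le f hp fun k hk => Nat.cast_le.2 (hB k hk)⟩
  · obtain ⟨p₀, h⟩ := h₂
    exact ⟨p₀, fun p hp hpp =>
      localSum_le_of_rootCount_le f hp fun k hk => Nat.cast_le.2 (h p hp hpp k hk)⟩

lemma not_natCast_dvd_of_natAbs_lt {c : ℤ} (hc : c ≠ 0) {q : ℕ} (h : c.natAbs < q) :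
    ¬ (q : ℤ) ∣ c := fun hd =>
  absurd (Nat.le_of_dvd (Int.natAbs_pos.2 hc) (Int.natCast_dvd.1 hd)) (by omega)

lemma LocallyTame.of_const {c : ℤ} (hc : c ≠ 0) : LocallyTame (C c) := by
  have key : ∀ q : ℕ, c.natAbs < q → rootCount (C c) q = 0 := by
    intro q hq
    have := not_natCast_dvd_of_natAbs_lt hc hq
    simp [rootCount, this]
  refine LocallyTame.of_rootCount_le (fun p hp => ⟨c.natAbs, fun k _ => ?_⟩)
    ⟨c.natAbs + 1, fun p hp hpp k hk => ?_⟩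
  · rcases le_or_gt (p ^ k) c.natAbs with h | h
    · exact (rootCount_le _ _).trans h
    · rw [key _ h]
      exact Nat.zero_le _
  · rw [key]
    · simp
    · exact lt_of_lt_of_le (by omega) (Nat.le_self_pow (by omega) p)

lemma LocallyTame.of_irreducible {g : ℤ[X]} (hg : Irreducible g) : LocallyTame g := by
  by_cases hdeg : g.natDegree = 0
  · rw [eq_C_of_natDegree_eq_zero hdeg] at hg ⊢
    exact LocallyTame.of_const fun h => hg.ne_zero (by rw [h, C_0])
  obtain ⟨u, w, R, hR0, hR⟩ := exists_bezout_derivative_of_irreducible hg hdeg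
  refine LocallyTame.of_rootCount_le (fun p hp => ?_) ⟨R.natAbs + g.leadingCoeff.natAbs + 1, ?_⟩
  · obtain ⟨ρ, hρ⟩ : ∃ ρ, R.natAbs < p ^ (ρ + 1) :=
      ⟨R.natAbs, (Nat.lt_pow_self hp.one_lt).trans (Nat.pow_lt_pow_right hp.one_lt (by omega))⟩
    have hρ' : ¬ (p : ℤ) ^ (ρ + 1) ∣ R := by
      exact_mod_cast not_natCast_dvd_of_natAbs_lt hR0 hρ
    refine ⟨p ^ ρ * p ^ (ρ + 1), fun k _ => ?_⟩
    rcases le_or_gt (ρ + 1) k with hk | hk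
    · exact (rootCount_pow_le hR hp hρ' hk).trans (Nat.mul_le_mul_left _ (rootCount_le _ _))
    · calc rootCount g (p ^ k) ≤ p ^ k := rootCount_le _ _
        _ ≤ p ^ (ρ + 1) := Nat.pow_le_pow_right hp.pos hk.le
        _ ≤ p ^ ρ * p ^ (ρ + 1) := Nat.le_mul_of_pos_left _ (pow_pos hp.pos _)
  · intro p hp hpp k hk
    have h1 : ¬ (p : ℤ) ^ (0 + 1) ∣ R := by
      simpa using not_natCast_dvd_of_natAbs_lt hR0 (by omega : R.natAbs < p)
    have h2 := rootCount_pow_le hR hp h1 (by omega : 0 + 1 ≤ k)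
    simp only [pow_zero, one_mul, zero_add, pow_one] at h2
    exact h2.trans (rootCount_prime_le hp (not_natCast_dvd_of_natAbs_lt
      (leadingCoeff_ne_zero.2 hg.ne_zero) (by omega)))

lemma LocallyTame.mul {f g : ℤ[X]} (hf0 : f ≠ 0) (hg0 : g ≠ 0) (hf : LocallyTame f)
    (hg : LocallyTame g) : LocallyTame (f * g) := by
  refine ⟨fun p hp => ?_, ?_⟩
  · obtain ⟨A, hA⟩ := hf.bounded p hp
    obtain ⟨B, hB⟩ := hg.bounded p hp
    exact ⟨A + B, fun K => (localSum_mul_le f g hp K).trans (add_le_add (hA K) (hB K))⟩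
  · obtain ⟨a, ha⟩ := hf.eventually_le
    obtain ⟨b, hb⟩ := hg.eventually_le
    refine ⟨max a b, fun p hp hpp K => (localSum_mul_le f g hp K).trans ?_⟩
    rw [natDegree_mul hf0 hg0, Nat.cast_add, add_div]
    exact add_le_add (ha p hp (le_trans (le_max_left _ _) hpp) K)
      (hb p hp (le_trans (le_max_right _ _) hpp) K)

lemma LocallyTame.of_ne_zero {f : ℤ[X]} (hf : f ≠ 0) : LocallyTame f := by
  induction f using WfDvdMonoid.induction_on_irreducible with
  | zero => exact absurd rfl hf
  | unit u hu =>
    obtain ⟨c, hc, rfl⟩ := Polynomial.isUnit_iff.1 hu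
    exact LocallyTame.of_const hc.ne_zero
  | mul a i ha hi ih => exact (LocallyTame.of_irreducible hi).mul hi.ne_zero ha (ih ha)

lemma sum_Icc_rpow_neg_le {s : ℝ} (hs : 1 < s) (M : ℕ) :
    ∑ m ∈ Finset.Icc 1 M, (m : ℝ) ^ (-s) ≤ 1 + 1 / (s - 1) := by
  have hs0 : 0 < s - 1 := by linarith
  have key : ∀ M : ℕ, ∑ m ∈ Finset.Icc 1 (M + 1), (m : ℝ) ^ (-s) ≤
      1 + (1 - ((M + 1 : ℕ) : ℝ) ^ (-(s - 1))) / (s - 1) := by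
    intro M
    induction M with
    | zero => simp
    | succ M ih =>
      rw [Finset.sum_Icc_succ_top (by omega)]
      set a : ℝ := ((M + 1 : ℕ) : ℝ) with ha
      have ha1 : 1 ≤ a := by rw [ha]; exact_mod_cast Nat.succ_pos M
      have hb : ((M + 1 + 1 : ℕ) : ℝ) = a + 1 := by rw [ha]; push_cast; ring
      rw [hb]
      have h1 : (a + 1) ^ (-(s - 1)) * (1 + (s - 1) / (a + 1)) ≤ a ^ (-(s - 1)) := by
        have hlog : 1 / (a + 1) ≤ Real.log (a + 1) - Real.log a := by
          have := Real.log_le_sub_one_of_pos (show 0 < a / (a + 1) by positivity)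
          rw [Real.log_div (by positivity) (by positivity)] at this
          have h2 : a / (a + 1) - 1 = - (1 / (a + 1)) := by field_simp; ring
          linarith
        rw [Real.rpow_def_of_pos (by positivity), Real.rpow_def_of_pos (by positivity)]
        calc _ ≤ Real.exp (Real.log (a + 1) * -(s - 1)) * Real.exp ((s - 1) / (a + 1)) := by
              gcongr
              rw [add_comm]
              exact Real.add_one_le_exp _
          _ = Real.exp (Real.log (a + 1) * -(s - 1) + (s - 1) * (1 / (a + 1))) := by
              rw [← Real.exp_add]; ring_nf
          _ ≤ Real.exp (Real.log a * -(s - 1)) := by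
              rw [Real.exp_le_exp]
              nlinarith [mul_le_mul_of_nonneg_left hlog hs0.le]
      have h2 : (a + 1) ^ (-s) = (a + 1) ^ (-(s - 1)) / (a + 1) := by
        rw [show -s = -(s - 1) - 1 by ring, Real.rpow_sub_one (by positivity)]
      rw [h2]
      have h3 : (a + 1) ^ (-(s - 1)) / (a + 1) ≤
          (a ^ (-(s - 1)) - (a + 1) ^ (-(s - 1))) / (s - 1) := by
        rw [le_div_iff₀ hs0]
        calc _ = (a + 1) ^ (-(s - 1)) * ((s - 1) / (a + 1)) := by ring
          _ ≤ _ := by linarith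
      calc _ ≤ 1 + (1 - a ^ (-(s - 1))) / (s - 1) +
            (a ^ (-(s - 1)) - (a + 1) ^ (-(s - 1))) / (s - 1) := add_le_add ih h3
        _ = _ := by ring
  calc ∑ m ∈ Finset.Icc 1 M, (m : ℝ) ^ (-s)
      ≤ ∑ m ∈ Finset.Icc 1 (M + 1), (m : ℝ) ^ (-s) :=
        Finset.sum_le_sum_of_subset_of_nonneg (Finset.Icc_subset_Icc_right (by omega))
          fun _ _ _ => by positivity
    _ ≤ 1 + (1 - ((M + 1 : ℕ) : ℝ) ^ (-(s - 1))) / (s - 1) := key M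
    _ ≤ 1 + 1 / (s - 1) := by
        gcongr
        linarith [show (0 : ℝ) ≤ ((M + 1 : ℕ) : ℝ) ^ (-(s - 1)) by positivity]

lemma prod_primesBelow_inv_one_sub_rpow_le {s : ℝ} (hs : 1 < s) (X : ℕ) :
    ∏ p ∈ X.primesBelow, (1 - (p : ℝ) ^ (-s))⁻¹ ≤ 1 + 1 / (s - 1) := by
  let φ : ℕ →* ℝ :=
    { toFun := fun m => (m : ℝ) ^ (-s)
      map_one' := by simp
      map_mul' := fun a b => by
        push_cast
        exact Real.mul_rpow (by positivity) (by positivity) }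
  have h := (EulerProduct.summable_and_hasSum_smoothNumbers_prod_primesBelow_geometric (f := φ)
    (fun {p} hp => by
      have hp1 : (1 : ℝ) < p := by exact_mod_cast hp.one_lt
      change ‖(p : ℝ) ^ (-s)‖ < 1
      rw [Real.norm_of_nonneg (by positivity)]
      exact Real.rpow_lt_one_of_one_lt_of_neg hp1 (by linarith)) X).2
  refine hasSum_le_of_sum_le h fun t => ?_
  obtain ⟨M, hM⟩ := (t.map (Function.Embedding.subtype _)).bddAbove
  refine le_trans ?_ (sum_Icc_rpow_neg_le hs M)
  refine (Finset.sum_map t (Function.Embedding.subtype _) fun m : ℕ => (m : ℝ) ^ (-s)).symm.le.trans ?_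
  refine Finset.sum_le_sum_of_subset_of_nonneg (fun m hm => ?_) fun _ _ _ => by positivity
  refine Finset.mem_Icc.2 ⟨?_, hM hm⟩
  obtain ⟨y, -, rfl⟩ := Finset.mem_map.1 hm
  exact Nat.one_le_iff_ne_zero.2 (Nat.ne_zero_of_mem_smoothNumbers y.2)

lemma sum_range_rootCount_pow_le (f : ℤ[X]) {p : ℕ} (hp : p.Prime) {s : ℝ} (hs : 1 < s) (K : ℕ) :
    ∑ k ∈ Finset.range (K + 1), (rootCount f (p ^ k) : ℝ) * ((p ^ k : ℕ) : ℝ) ^ (-s) ≤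
      1 + (p : ℝ) ^ (1 - s) * localSum f p K := by
  have hp1 : (1 : ℝ) < p := by exact_mod_cast hp.one_lt
  induction K with
  | zero => simp [rootCount_one, localSum]
  | succ K ih =>
    rw [Finset.sum_range_succ, localSum, Finset.sum_Icc_succ_top (by omega), mul_add, ← add_assoc]
    refine add_le_add ih ?_
    have h1 : (((p ^ (K + 1) : ℕ) : ℝ)) ^ (-s) =
        ((p : ℝ) ^ (1 - s)) ^ (K + 1) / (p : ℝ) ^ (K + 1) := by
      push_cast
      rw [← div_pow, ← Real.rpow_sub_one (by positivity), ← Real.rpow_natCast,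
        ← Real.rpow_natCast, ← Real.rpow_mul (by positivity), ← Real.rpow_mul (by positivity)]
      ring_nf
    have h2 : ((p : ℝ) ^ (1 - s)) ^ (K + 1) ≤ (p : ℝ) ^ (1 - s) :=
      pow_le_of_le_one (by positivity)
        (Real.rpow_le_one_of_one_le_of_nonpos hp1.le (by linarith)) (by omega)
    calc _ ≤ (rootCount f (p ^ (K + 1)) : ℝ) * ((p : ℝ) ^ (1 - s) / (p : ℝ) ^ (K + 1)) := by
          rw [h1]; gcongr
      _ = _ := by ring

lemma rpow_one_sub_div_le {p s : ℝ} (hp : 2 ≤ p) (hs : 1 < s) :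
    p ^ (1 - s) / (p - 1) ≤ p ^ (-s) + 2 / p ^ 2 := by
  have hp0 : 0 < p := by linarith
  have hp1 : 0 < p - 1 := by linarith
  have h1 : p ^ (1 - s) = p * p ^ (-s) := by
    rw [show 1 - s = -s + 1 by ring, Real.rpow_add_one hp0.ne']
    ring
  have h2 : p ^ (-s) ≤ 1 / p := by
    rw [one_div, ← Real.rpow_neg_one]
    exact Real.rpow_le_rpow_of_exponent_le (by linarith) (by linarith)
  have h3 : p ^ (1 - s) / (p - 1) = p ^ (-s) + p ^ (-s) * (1 / (p - 1)) := by
    rw [h1]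
    field_simp
    ring
  have h4 : 1 / (p - 1) ≤ 2 / p := by
    rw [div_le_div_iff₀ hp1 hp0]
    linarith
  rw [h3]
  have h5 : p ^ (-s) * (1 / (p - 1)) ≤ 1 / p * (2 / p) := by gcongr
  calc _ ≤ p ^ (-s) + 1 / p * (2 / p) := by gcongr
    _ = _ := by ring

/-- The Dirichlet series of the root counts is dominated by a constant times
`(1 + 1 / (s - 1)) ^ deg f` for `s > 1`. -/
lemma exists_sum_rootCount_rpow_le {f : ℤ[X]} (hf : f ≠ 0) :
    ∃ A : ℝ, 0 < A ∧ ∀ s : ℝ, 1 < s → ∀ X : ℕ,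
      ∑ d ∈ Finset.Icc 1 X, (rootCount f d : ℝ) * (d : ℝ) ^ (-s) ≤
        A * (1 + 1 / (s - 1)) ^ f.natDegree := by
  obtain ⟨hbdd, p₀, hp₀⟩ := LocallyTame.of_ne_zero hf
  choose! B hB using hbdd
  set n := f.natDegree with hn
  set c : ℕ → ℝ := fun p => if p < p₀ then |B p| else 0 with hc
  set Z : ℝ := ∑' m : ℕ, 1 / (m : ℝ) ^ 2 with hZ
  have hZs : Summable fun m : ℕ => 1 / (m : ℝ) ^ 2 :=
    Real.summable_one_div_nat_pow.2 (by norm_num)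
  refine ⟨Real.exp (∑ p ∈ Finset.range p₀, |B p| + 2 * n * Z), Real.exp_pos _, fun s hs X => ?_⟩
  set F : ℕ → ℝ := fun d => (rootCount f d : ℝ) * (d : ℝ) ^ (-s) with hF
  have hF0 : ∀ d, 0 ≤ F d := fun d => by positivity
  have hlocal : ∀ p : ℕ, p.Prime → ∀ K,
      ∑ k ∈ Finset.range K, F (p ^ k) ≤ Real.exp (c p + n * (p : ℝ) ^ (-s) + n * (2 / (p : ℝ) ^ 2)) := by
    intro p hp K
    have hp2 : (2 : ℝ) ≤ p := by exact_mod_cast hp.two_le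
    have h0 : ∑ k ∈ Finset.range K, F (p ^ k) ≤ ∑ k ∈ Finset.range (K + 1), F (p ^ k) :=
      Finset.sum_le_sum_of_subset_of_nonneg (Finset.range_mono (by omega)) fun _ _ _ => hF0 _
    refine h0.trans ((sum_range_rootCount_pow_le f hp hs K).trans ?_)
    rw [add_comm]
    refine le_trans ?_ (Real.add_one_le_exp _)
    gcongr
    by_cases hpp : p < p₀
    · have h1 : (p : ℝ) ^ (1 - s) ≤ 1 :=
        Real.rpow_le_one_of_one_le_of_nonpos (by linarith) (by linarith)
      have h2 : localSum f p K ≤ |B p| := (hB p hp K).trans (le_abs_self _)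
      have h3 : (p : ℝ) ^ (1 - s) * localSum f p K ≤ 1 * |B p| :=
        mul_le_mul h1 h2 (by unfold localSum; positivity) zero_le_one
      simp only [hc, hpp, if_true]
      have : (0 : ℝ) ≤ n * (p : ℝ) ^ (-s) + n * (2 / (p : ℝ) ^ 2) := by positivity
      linarith
    · simp only [hc, hpp, if_false, zero_add]
      calc (p : ℝ) ^ (1 - s) * localSum f p K ≤ (p : ℝ) ^ (1 - s) * (n / ((p : ℝ) - 1)) := by
            gcongr
            exact hp₀ p hp (not_lt.1 hpp) K
        _ = n * ((p : ℝ) ^ (1 - s) / ((p : ℝ) - 1)) := by ring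
        _ ≤ n * ((p : ℝ) ^ (-s) + 2 / (p : ℝ) ^ 2) := by
            gcongr
            exact rpow_one_sub_div_le hp2 hs
        _ = _ := by ring
  have hsum : ∀ {p : ℕ}, p.Prime → Summable fun k => ‖F (p ^ k)‖ := by
    intro p hp
    simp only [Real.norm_of_nonneg (hF0 _)]
    exact summable_of_sum_range_le (fun _ => hF0 _) (hlocal p hp)
  obtain ⟨-, hprod⟩ := EulerProduct.summable_and_hasSum_smoothNumbers_prod_primesBelow_tsum
    (f := F) (by simp [hF, rootCount_one])
    (fun {a b} hab => by
      simp only [hF, rootCount_mul_of_coprime f hab]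
      push_cast
      rw [Real.mul_rpow (by positivity) (by positivity)]
      ring) hsum (X + 1)
  have hle : ∑ d ∈ Finset.Icc 1 X, F d ≤ ∏ p ∈ (X + 1).primesBelow, ∑' k, F (p ^ k) := by
    have hmem : ∀ d ∈ Finset.Icc 1 X, d ∈ (X + 1).smoothNumbers := fun d hd => by
      rw [Finset.mem_Icc] at hd
      exact Nat.mem_smoothNumbers_of_lt (by omega) (by omega)
    rw [← Finset.sum_subtype_of_mem F hmem]
    exact sum_le_hasSum _ (fun _ _ => hF0 _) hprod
  refine hle.trans ?_
  calc ∏ p ∈ (X + 1).primesBelow, ∑' k, F (p ^ k)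
      ≤ ∏ p ∈ (X + 1).primesBelow,
        Real.exp (c p + n * (p : ℝ) ^ (-s) + n * (2 / (p : ℝ) ^ 2)) :=
        Finset.prod_le_prod (fun p _ => tsum_nonneg fun _ => hF0 _) fun p hp =>
          Real.tsum_le_of_sum_range_le (fun _ => hF0 _)
            (hlocal p (Nat.prime_of_mem_primesBelow hp))
    _ = Real.exp (∑ p ∈ (X + 1).primesBelow, c p +
          2 * n * ∑ p ∈ (X + 1).primesBelow, 1 / (p : ℝ) ^ 2) *
        (∏ p ∈ (X + 1).primesBelow, Real.exp ((p : ℝ) ^ (-s))) ^ n := by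
        rw [← Real.exp_sum, ← Real.exp_sum, ← Real.exp_nat_mul, ← Real.exp_add,
          Finset.sum_add_distrib, Finset.sum_add_distrib, ← Finset.mul_sum, ← Finset.mul_sum]
        congr 1
        simp only [div_eq_mul_inv, ← Finset.mul_sum]
        ring
    _ ≤ Real.exp (∑ p ∈ Finset.range p₀, |B p| + 2 * n * Z) * (1 + 1 / (s - 1)) ^ n := by
        gcongr
        · rw [hc, ← Finset.sum_filter]
          refine Finset.sum_le_sum_of_subset_of_nonneg (fun p hp => ?_) fun _ _ _ => abs_nonneg _
          exact Finset.mem_range.2 (Finset.mem_filter.1 hp).2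
        · exact hZs.sum_le_tsum _ fun _ _ => by positivity
        · refine le_trans (Finset.prod_le_prod (fun _ _ => (Real.exp_pos _).le) fun p hp => ?_)
            (prod_primesBelow_inv_one_sub_rpow_le hs (X + 1))
          have hp1 : (1 : ℝ) < p := by
            exact_mod_cast (Nat.prime_of_mem_primesBelow hp).one_lt
          have h1 : (p : ℝ) ^ (-s) < 1 := Real.rpow_lt_one_of_one_lt_of_neg hp1 (by linarith)
          rw [← inv_inv (Real.exp _), ← Real.exp_neg]
          refine inv_anti₀ (by linarith) ?_
          linarith [Real.add_one_le_exp (-(p : ℝ) ^ (-s))]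

lemma sum_rootCount_div_le {f : ℤ[X]} {A : ℝ}
    (hA : ∀ s : ℝ, 1 < s → ∀ X : ℕ, ∑ d ∈ Finset.Icc 1 X, (rootCount f d : ℝ) * (d : ℝ) ^ (-s) ≤
      A * (1 + 1 / (s - 1)) ^ f.natDegree) {D : ℕ} (hD : 2 ≤ D) :
    ∑ d ∈ Finset.Icc 1 D, (rootCount f d : ℝ) / d ≤
      Real.exp 1 * A * (1 + Real.log D) ^ f.natDegree := by
  have hD1 : (1 : ℝ) < D := by exact_mod_cast hD
  have hL : 0 < Real.log D := Real.log_pos hD1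
  have h := hA (1 + 1 / Real.log D) (by simp [hL]) D
  rw [add_sub_cancel_left, one_div_one_div] at h
  calc _ ≤ ∑ d ∈ Finset.Icc 1 D,
        Real.exp 1 * ((rootCount f d : ℝ) * (d : ℝ) ^ (-(1 + 1 / Real.log D))) := by
        refine Finset.sum_le_sum fun d hd => ?_
        rw [Finset.mem_Icc] at hd
        have hd0 : (0 : ℝ) < d := by exact_mod_cast hd.1
        have h1 : (d : ℝ) ^ (1 / Real.log D) ≤ Real.exp 1 := by
          rw [Real.rpow_def_of_pos hd0, Real.exp_le_exp, mul_one_div, div_le_one hL]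
          exact Real.log_le_log hd0 (by exact_mod_cast hd.2)
        have h2 : (d : ℝ) ^ (1 / Real.log D) * (d : ℝ) ^ (-(1 + 1 / Real.log D)) = 1 / d := by
          rw [← Real.rpow_add hd0, show 1 / Real.log D + -(1 + 1 / Real.log D) = -1 by ring,
            Real.rpow_neg_one, one_div]
        calc (rootCount f d : ℝ) / d = rootCount f d * (1 / d) := by ring
          _ = (d : ℝ) ^ (1 / Real.log D) *
              ((rootCount f d : ℝ) * (d : ℝ) ^ (-(1 + 1 / Real.log D))) := by rw [← h2]; ring
          _ ≤ _ := by gcongr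
    _ = Real.exp 1 * ∑ d ∈ Finset.Icc 1 D,
        ((rootCount f d : ℝ) * (d : ℝ) ^ (-(1 + 1 / Real.log D))) := by rw [Finset.mul_sum]
    _ ≤ _ := by
        rw [mul_assoc]
        gcongr

lemma sum_range_succ_eq_sum_Icc_one {G : ℕ → ℝ} (hG : G 0 = 0) (Y : ℕ) :
    ∑ d ∈ Finset.range (Y + 1), G d = ∑ d ∈ Finset.Icc 1 Y, G d := by
  rw [Finset.range_eq_Ico, Finset.sum_eq_sum_Ico_succ_bot (by omega), hG, zero_add]
  rfl

lemma exists_hasSum_rootCount_div_sq {f : ℤ[X]} {A : ℝ}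
    (hA : ∀ s : ℝ, 1 < s → ∀ X : ℕ, ∑ d ∈ Finset.Icc 1 X, (rootCount f d : ℝ) * (d : ℝ) ^ (-s) ≤
      A * (1 + 1 / (s - 1)) ^ f.natDegree) :
    ∃ β : ℝ, HasSum (fun d : ℕ+ => (rootCount f (d : ℕ) : ℝ) / ((d : ℕ) : ℝ) ^ 2) β ∧
      (∀ D, ∑ d ∈ Finset.Icc 1 D, (rootCount f d : ℝ) / (d : ℝ) ^ 2 ≤ β) ∧
      ∀ M D : ℕ, 0 < M → M ^ 2 ≤ D →
        β - ∑ d ∈ Finset.Icc 1 D, (rootCount f d : ℝ) / (d : ℝ) ^ 2 ≤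
          A * 3 ^ f.natDegree / M := by
  set G : ℕ → ℝ := fun d => (rootCount f d : ℝ) / (d : ℝ) ^ 2 with hG
  have hG0 : G 0 = 0 := by simp [hG]
  have hGnn : ∀ d, 0 ≤ G d := fun d => by positivity
  have hsum : Summable G := by
    refine summable_of_sum_range_le (c := A * (1 + 1 / ((2 : ℝ) - 1)) ^ f.natDegree) hGnn fun m => ?_
    refine le_trans (Finset.sum_le_sum_of_subset_of_nonneg
      (Finset.range_mono (Nat.le_succ m)) fun _ _ _ => hGnn _) ?_
    rw [sum_range_succ_eq_sum_Icc_one hG0]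
    refine le_trans (le_of_eq (Finset.sum_congr rfl fun d _ => ?_)) (hA 2 (by norm_num) m)
    rw [Real.rpow_neg (by positivity), Real.rpow_ofNat]
    exact div_eq_mul_inv _ _
  refine ⟨∑' d, G d, ?_, ?_, ?_⟩
  · refine (PNat.coe_injective.hasSum_iff (f := G) fun d hd => ?_).2 hsum.hasSum
    rcases Nat.eq_zero_or_pos d with rfl | hd0
    · exact hG0
    · exact absurd ⟨⟨d, hd0⟩, rfl⟩ hd
  · exact fun D => hsum.sum_le_tsum _ fun _ _ => hGnn _
  · intro M D hM hMD
    have hlim := (hsum.hasSum.tendsto_sum_nat).comp (Filter.tendsto_add_atTop_nat 1)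
    rw [sub_le_iff_le_add]
    refine le_of_tendsto hlim (Filter.eventually_atTop.2 ⟨D, fun Y hY => ?_⟩)
    simp only [Function.comp_apply]
    rw [sum_range_succ_eq_sum_Icc_one hG0, ← Finset.sum_sdiff (Finset.Icc_subset_Icc_right hY)]
    gcongr
    have hM0 : (0 : ℝ) < M := by exact_mod_cast hM
    have hA' := hA (3 / 2) (by norm_num) Y
    calc ∑ d ∈ Finset.Icc 1 Y \ Finset.Icc 1 D, G d
        ≤ ∑ d ∈ Finset.Icc 1 Y \ Finset.Icc 1 D,
          (rootCount f d : ℝ) * (d : ℝ) ^ (-(3 / 2) : ℝ) / M := by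
          refine Finset.sum_le_sum fun d hd => ?_
          simp only [Finset.mem_sdiff, Finset.mem_Icc, not_and, not_le] at hd
          have hd0 : (0 : ℝ) < d := by exact_mod_cast hd.1.1
          have hdM : (M : ℝ) ^ 2 ≤ d := by
            exact_mod_cast hMD.trans (hd.2 hd.1.1).le
          have h1 : (d : ℝ) ^ (-(1 / 2) : ℝ) ≤ 1 / M := by
            rw [Real.rpow_neg hd0.le, ← Real.sqrt_eq_rpow, ← one_div]
            gcongr
            exact Real.le_sqrt_of_sq_le hdM
          have h2 : (1 : ℝ) / (d : ℝ) ^ 2 = (d : ℝ) ^ (-(3 / 2) : ℝ) * (d : ℝ) ^ (-(1 / 2) : ℝ) := by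
            rw [← Real.rpow_add hd0, show (-(3 / 2) + -(1 / 2) : ℝ) = -2 by norm_num,
              Real.rpow_neg hd0.le, Real.rpow_ofNat, one_div]
          calc G d = rootCount f d * (1 / (d : ℝ) ^ 2) := by rw [hG]; ring
            _ = rootCount f d * (d : ℝ) ^ (-(3 / 2) : ℝ) * (d : ℝ) ^ (-(1 / 2) : ℝ) := by
                rw [h2]; ring
            _ ≤ rootCount f d * (d : ℝ) ^ (-(3 / 2) : ℝ) * (1 / M) := by gcongr
            _ = _ := by ring
      _ ≤ ∑ d ∈ Finset.Icc 1 Y, (rootCount f d : ℝ) * (d : ℝ) ^ (-(3 / 2) : ℝ) / M :=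
          Finset.sum_le_sum_of_subset_of_nonneg Finset.sdiff_subset fun _ _ _ => by positivity
      _ ≤ A * 3 ^ f.natDegree / M := by
          rw [← Finset.sum_div]
          gcongr
          refine hA'.trans (le_of_eq ?_)
          norm_num

lemma abs_sum_mul_le_of_monotone {w c : ℕ → ℝ} {B : ℝ} (hw : Monotone w) (hw0 : 0 ≤ w 0)
    (hc : ∀ t, |∑ i ∈ Finset.range t, c i| ≤ B) (M : ℕ) :
    |∑ i ∈ Finset.range (M + 1), w i * c i| ≤ 2 * B * w M := by
  have hB : 0 ≤ B := (abs_nonneg _).trans (hc 0)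
  have h := Finset.sum_range_by_parts w c (M + 1)
  simp only [smul_eq_mul, Nat.add_sub_cancel] at h
  rw [h]
  have hwM : 0 ≤ w M := hw0.trans (hw (Nat.zero_le M))
  calc _ ≤ |w M * ∑ i ∈ Finset.range (M + 1), c i| +
        |∑ i ∈ Finset.range M, (w (i + 1) - w i) * ∑ i ∈ Finset.range (i + 1), c i| := abs_sub _ _
    _ ≤ w M * B + ∑ i ∈ Finset.range M, (w (i + 1) - w i) * B := by
        refine add_le_add ?_ ((Finset.abs_sum_le_sum_abs _ _).trans
          (Finset.sum_le_sum fun i _ => ?_))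
        · rw [abs_mul, abs_of_nonneg hwM]
          gcongr
          exact hc _
        · have : 0 ≤ w (i + 1) - w i := sub_nonneg.2 (hw (Nat.le_succ i))
          rw [abs_mul, abs_of_nonneg this]
          gcongr
          exact hc _
    _ = w M * B + (w M - w 0) * B := by rw [← Finset.sum_mul, Finset.sum_range_sub]
    _ ≤ 2 * B * w M := by nlinarith [mul_nonneg hw0 hB]

lemma succ_mul_pow_le_pow_sub_pow {y : ℝ} (hy : 0 ≤ y) (k : ℕ) :
    (k + 1) * y ^ k ≤ (y + 1) ^ (k + 1) - y ^ (k + 1) := by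
  induction k with
  | zero => simp
  | succ k ih =>
    have h1 : 0 ≤ (k + 1) * y ^ k := by positivity
    have h2 : (y + 1) * ((k + 1) * y ^ k + y ^ (k + 1)) ≤ (y + 1) * (y + 1) ^ (k + 1) := by
      gcongr
      linarith
    push_cast
    rw [pow_succ' (y + 1) (k + 1)]
    have h3 : y ^ (k + 1) = y * y ^ k := by ring
    have h4 : y ^ (k + 1 + 1) = y * (y * y ^ k) := by ring
    rw [h3] at h2 ⊢
    rw [h4]
    nlinarith

lemma abs_sum_pow_sub_le (j M : ℕ) :
    |∑ i ∈ Finset.range M, ((i : ℝ) + 1) ^ j - (M : ℝ) ^ (j + 1) / (j + 1)| ≤ (M : ℝ) ^ j := by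
  have hj : (0 : ℝ) < j + 1 := by positivity
  have lower : (M : ℝ) ^ (j + 1) / (j + 1) ≤ ∑ i ∈ Finset.range M, ((i : ℝ) + 1) ^ j := by
    induction M with
    | zero => simp
    | succ M ih =>
      rw [Finset.sum_range_succ]
      have h := abs_pow_sub_pow_le ((M : ℝ) + 1) M (j + 1)
      have h1 : ((M : ℝ) + 1) ^ (j + 1) - (M : ℝ) ^ (j + 1) ≤ (j + 1) * ((M : ℝ) + 1) ^ j := by
        refine (le_abs_self _).trans (h.trans (le_of_eq ?_))
        rw [abs_of_nonneg (by positivity : (0 : ℝ) ≤ (M : ℝ) + 1), Nat.abs_cast,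
          max_eq_left (by linarith)]
        simp
      have h2 : ((M : ℝ) + 1) ^ (j + 1) / (j + 1) - (M : ℝ) ^ (j + 1) / (j + 1) ≤
          ((M : ℝ) + 1) ^ j := by
        rw [← sub_div, div_le_iff₀ hj]
        linarith
      push_cast
      linarith
  have upper : ∑ i ∈ Finset.range M, ((i : ℝ) + 1) ^ j ≤
      (M : ℝ) ^ (j + 1) / (j + 1) + (M : ℝ) ^ j := by
    clear lower
    induction M with
    | zero => simp
    | succ M ih =>
      rw [Finset.sum_range_succ]
      have h1 := succ_mul_pow_le_pow_sub_pow (Nat.cast_nonneg M : (0 : ℝ) ≤ M) j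
      have h2 : (M : ℝ) ^ j ≤
          ((M : ℝ) + 1) ^ (j + 1) / (j + 1) - (M : ℝ) ^ (j + 1) / (j + 1) := by
        rw [← sub_div, le_div_iff₀ hj]
        linarith
      push_cast
      linarith
  rw [abs_le]
  constructor <;> linarith [show (0 : ℝ) ≤ (M : ℝ) ^ j by positivity]

lemma intCast_eval_natCast_eq_sum (f : ℤ[X]) (m : ℕ) :
    ((f.eval (m : ℤ) : ℤ) : ℝ) =
      ∑ j ∈ Finset.range (f.natDegree + 1), (f.coeff j : ℝ) * (m : ℝ) ^ j := by
  rw [eval_eq_sum_range]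
  push_cast
  rfl

/-- The sum of the absolute values of the coefficients. -/
noncomputable def coeffSum (f : ℤ[X]) : ℝ :=
  ∑ j ∈ Finset.range (f.natDegree + 1), |(f.coeff j : ℝ)|

lemma coeffSum_nonneg (f : ℤ[X]) : 0 ≤ coeffSum f :=
  Finset.sum_nonneg fun _ _ => abs_nonneg _

lemma abs_sum_coeff_mul_le (f : ℤ[X]) {u : ℕ → ℝ} {b : ℝ}
    (hu : ∀ j ≤ f.natDegree, |u j| ≤ b) :
    |∑ j ∈ Finset.range (f.natDegree + 1), (f.coeff j : ℝ) * u j| ≤ coeffSum f * b := by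
  rw [coeffSum, Finset.sum_mul]
  refine (Finset.abs_sum_le_sum_abs _ _).trans (Finset.sum_le_sum fun j hj => ?_)
  rw [abs_mul]
  gcongr
  exact hu j (Nat.lt_succ_iff.1 (Finset.mem_range.1 hj))

lemma abs_sum_eval_sub_le (f : ℤ[X]) {M : ℕ} (hM : 0 < M) :
    |∑ m ∈ Finset.Icc 1 M, ((f.eval (m : ℤ) : ℤ) : ℝ) -
      f.leadingCoeff / (f.natDegree + 1) * (M : ℝ) ^ (f.natDegree + 1)| ≤
      coeffSum f * (M : ℝ) ^ f.natDegree := by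
  have hM1 : (1 : ℝ) ≤ M := by exact_mod_cast hM
  set n := f.natDegree with hn
  set u : ℕ → ℝ := fun j => ∑ i ∈ Finset.range M, ((i : ℝ) + 1) ^ j -
    if j = n then (M : ℝ) ^ (n + 1) / (n + 1) else 0 with hu
  have h : ∑ m ∈ Finset.Icc 1 M, ((f.eval (m : ℤ) : ℤ) : ℝ) -
      f.leadingCoeff / (n + 1) * (M : ℝ) ^ (n + 1) =
      ∑ j ∈ Finset.range (f.natDegree + 1), (f.coeff j : ℝ) * u j := by
    simp only [hu, mul_sub, Finset.sum_sub_distrib, mul_ite, mul_zero, Finset.sum_ite_eq',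
      ← hn, Finset.mem_range, Nat.lt_succ_self, if_true]
    congr 1
    · simp only [Finset.mul_sum]
      rw [Finset.sum_comm, ← Finset.Ico_add_one_right_eq_Icc, Finset.sum_Ico_eq_sum_range]
      refine Finset.sum_congr rfl fun i _ => ?_
      rw [intCast_eval_natCast_eq_sum]
      push_cast
      simp only [add_comm (1 : ℝ), ← hn]
    · rw [leadingCoeff]
      ring
  rw [h]
  refine abs_sum_coeff_mul_le f fun j hj => ?_
  simp only [hu]
  split_ifs with hjn
  · rw [hjn]
    exact abs_sum_pow_sub_le n M
  · rw [sub_zero, abs_of_nonneg (by positivity)]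
    calc ∑ i ∈ Finset.range M, ((i : ℝ) + 1) ^ j ≤ ∑ i ∈ Finset.range M, (M : ℝ) ^ j := by
          refine Finset.sum_le_sum fun i hi => ?_
          gcongr
          exact_mod_cast Finset.mem_range.1 hi
      _ = (M : ℝ) ^ (j + 1) := by simp [pow_succ']
      _ ≤ (M : ℝ) ^ n := pow_le_pow_right₀ hM1 (by omega)

lemma abs_sum_dvd_eval_sub_le (f : ℤ[X]) {d M : ℕ} (hd : 0 < d) (hM : 0 < M) :
    |∑ m ∈ Finset.Icc 1 M, (if (d : ℤ) ∣ f.eval (m : ℤ) then ((f.eval (m : ℤ) : ℤ) : ℝ) else 0) -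
      (rootCount f d : ℝ) / d * ∑ m ∈ Finset.Icc 1 M, ((f.eval (m : ℤ) : ℤ) : ℝ)| ≤
      coeffSum f * (2 * rootCount f d * (M : ℝ) ^ f.natDegree) := by
  obtain ⟨M, rfl⟩ : ∃ M', M = M' + 1 := ⟨M - 1, by omega⟩
  have hM1 : (1 : ℝ) ≤ ((M + 1 : ℕ) : ℝ) := by exact_mod_cast hM
  set P : ℕ → Prop := fun i => (d : ℤ) ∣ f.eval ((i + 1 : ℕ) : ℤ) with hP
  have hper : Function.Periodic P d := fun i => by
    simp only [hP]
    rw [show i + d + 1 = (i + 1) + d by ring]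
    exact periodic_dvd_eval f d (i + 1)
  have hcount : Nat.count P d = rootCount f d := by
    have h1 := Nat.filter_Ico_card_eq_of_periodic 1 d _ (periodic_dvd_eval f d)
    rw [rootCount_eq_count, ← h1, Nat.count_eq_card_filter_range, Finset.card_filter,
      Finset.card_filter, Finset.sum_Ico_eq_sum_range]
    simp [hP, add_comm]
  set c : ℕ → ℝ := fun i => (if P i then 1 else 0) - (rootCount f d : ℝ) / d with hc
  have hcsum : ∀ t, |∑ i ∈ Finset.range t, c i| ≤ rootCount f d := by
    intro t
    have h1 := abs_count_sub_le_of_periodic P hd hper t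
    rw [hcount] at h1
    refine le_trans (le_of_eq ?_) h1
    simp only [hc, Finset.sum_sub_distrib, Finset.sum_boole, Finset.sum_const, Finset.card_range,
      nsmul_eq_mul, Nat.count_eq_card_filter_range]
    congr 1
    ring
  have h : ∑ m ∈ Finset.Icc 1 (M + 1),
      (if (d : ℤ) ∣ f.eval (m : ℤ) then ((f.eval (m : ℤ) : ℤ) : ℝ) else 0) -
      (rootCount f d : ℝ) / d * ∑ m ∈ Finset.Icc 1 (M + 1), ((f.eval (m : ℤ) : ℤ) : ℝ) =
      ∑ j ∈ Finset.range (f.natDegree + 1),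
        (f.coeff j : ℝ) * ∑ i ∈ Finset.range (M + 1), ((i : ℝ) + 1) ^ j * c i := by
    simp only [Finset.mul_sum]
    rw [Finset.sum_comm, ← Finset.sum_sub_distrib, ← Finset.Ico_add_one_right_eq_Icc,
      Finset.sum_Ico_eq_sum_range]
    refine Finset.sum_congr rfl fun i _ => ?_
    have h2 := intCast_eval_natCast_eq_sum f (1 + i)
    have h3 : P i = ((d : ℤ) ∣ f.eval ((1 + i : ℕ) : ℤ)) := by rw [hP, add_comm 1 i]
    simp only [hc, ← mul_assoc, ← Finset.sum_mul, h3]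
    have h4 : ∑ j ∈ Finset.range (f.natDegree + 1), (f.coeff j : ℝ) * ((i : ℝ) + 1) ^ j =
        ((f.eval ((1 + i : ℕ) : ℤ) : ℤ) : ℝ) := by
      rw [h2]
      push_cast
      simp only [add_comm (1 : ℝ)]
    rw [h4]
    split_ifs <;> ring
  rw [h]
  refine abs_sum_coeff_mul_le f fun j hj => ?_
  have h5 := abs_sum_mul_le_of_monotone (w := fun i : ℕ => ((i : ℝ) + 1) ^ j)
    (fun a b hab => by dsimp only; gcongr) (by positivity) hcsum M
  refine h5.trans ?_
  gcongr
  push_cast at hM1 ⊢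
  exact pow_le_pow_right₀ hM1 hj

lemma sigmaZ_eq_sum {x : ℤ} (hx : 0 < x) {D : ℕ} (hD : x ≤ D) :
    (sigmaZ x : ℝ) = ∑ d ∈ Finset.Icc 1 D, if (d : ℤ) ∣ x then (x : ℝ) / d else 0 := by
  obtain ⟨a, rfl⟩ : ∃ a : ℕ, x = a := ⟨x.toNat, (Int.toNat_of_nonneg hx.le).symm⟩
  have ha : 0 < a := by exact_mod_cast hx
  have haD : a ≤ D := by exact_mod_cast hD
  have h1 : sigmaZ (a : ℤ) = ∑ d ∈ a.divisors, a / d := by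
    rw [sigmaZ, Int.toNat_natCast]
    exact (Nat.sum_div_divisors a fun d => d).symm
  have h2 : a.divisors = (Finset.Icc 1 D).filter fun d : ℕ => (d : ℤ) ∣ (a : ℤ) := by
    ext d
    simp only [Nat.mem_divisors, Finset.mem_filter, Finset.mem_Icc, Int.natCast_dvd_natCast]
    exact ⟨fun h => ⟨⟨Nat.pos_of_dvd_of_pos h.1 ha, (Nat.le_of_dvd ha h.1).trans haD⟩, h.1⟩,
      fun h => ⟨h.2, ha.ne'⟩⟩
  rw [← Finset.sum_filter, ← h2, h1]
  push_cast
  refine Finset.sum_congr rfl fun d hd => ?_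
  have hdpos := Nat.pos_of_mem_divisors hd
  exact Nat.cast_div (Nat.dvd_of_mem_divisors hd) (by exact_mod_cast hdpos.ne')

lemma abs_eval_le (f : ℤ[X]) {m M : ℕ} (hm : m ≤ M) (hM : 0 < M) :
    |((f.eval (m : ℤ) : ℤ) : ℝ)| ≤ coeffSum f * (M : ℝ) ^ f.natDegree := by
  have hM1 : (1 : ℝ) ≤ M := by exact_mod_cast hM
  rw [intCast_eval_natCast_eq_sum]
  refine abs_sum_coeff_mul_le f fun j hj => ?_
  rw [abs_of_nonneg (by positivity)]
  calc (m : ℝ) ^ j ≤ (M : ℝ) ^ j := by gcongr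
    _ ≤ (M : ℝ) ^ f.natDegree := pow_le_pow_right₀ hM1 hj

/-- Interchanging the sums over arguments and divisors. -/
lemma abs_sum_sigmaZ_sub_le {f : ℤ[X]} (hpos : ∀ m : ℕ, 0 < m → 0 < f.eval (m : ℤ)) {M D : ℕ}
    (hM : 0 < M) (hD : coeffSum f * (M : ℝ) ^ f.natDegree ≤ D) :
    |∑ m ∈ Finset.Icc 1 M, (sigmaZ (f.eval (m : ℤ)) : ℝ) -
      (∑ d ∈ Finset.Icc 1 D, (rootCount f d : ℝ) / (d : ℝ) ^ 2) *
        ∑ m ∈ Finset.Icc 1 M, ((f.eval (m : ℤ) : ℤ) : ℝ)| ≤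
      2 * coeffSum f * (M : ℝ) ^ f.natDegree * ∑ d ∈ Finset.Icc 1 D, (rootCount f d : ℝ) / d := by
  have h1 : ∑ m ∈ Finset.Icc 1 M, (sigmaZ (f.eval (m : ℤ)) : ℝ) =
      ∑ d ∈ Finset.Icc 1 D, (1 / (d : ℝ)) * ∑ m ∈ Finset.Icc 1 M,
        (if (d : ℤ) ∣ f.eval (m : ℤ) then ((f.eval (m : ℤ) : ℤ) : ℝ) else 0) := by
    simp only [Finset.mul_sum]
    rw [Finset.sum_comm]
    refine Finset.sum_congr rfl fun m hm => ?_
    rw [Finset.mem_Icc] at hm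
    have h2 : f.eval (m : ℤ) ≤ (D : ℤ) := by
      have := (le_abs_self _).trans ((abs_eval_le f hm.2 hM).trans hD)
      exact_mod_cast this
    rw [sigmaZ_eq_sum (hpos m hm.1) h2]
    refine Finset.sum_congr rfl fun d _ => ?_
    split_ifs
    · ring
    · simp
  rw [h1, Finset.sum_mul, ← Finset.sum_sub_distrib, Finset.mul_sum]
  refine (Finset.abs_sum_le_sum_abs _ _).trans (Finset.sum_le_sum fun d hd => ?_)
  have hd0 : 0 < d := (Finset.mem_Icc.1 hd).1
  have h3 := abs_sum_dvd_eval_sub_le f hd0 hM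
  set S := ∑ m ∈ Finset.Icc 1 M,
    (if (d : ℤ) ∣ f.eval (m : ℤ) then ((f.eval (m : ℤ) : ℤ) : ℝ) else 0)
  set E := ∑ m ∈ Finset.Icc 1 M, ((f.eval (m : ℤ) : ℤ) : ℝ)
  calc |1 / (d : ℝ) * S - rootCount f d / (d : ℝ) ^ 2 * E|
      = |1 / (d : ℝ) * (S - rootCount f d / (d : ℝ) * E)| := by
        congr 1
        ring
    _ = 1 / (d : ℝ) * |S - rootCount f d / (d : ℝ) * E| := by
        rw [abs_mul, abs_of_nonneg (by positivity)]
    _ ≤ 1 / (d : ℝ) * (coeffSum f * (2 * rootCount f d * (M : ℝ) ^ f.natDegree)) := by gcongr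
    _ = _ := by ring

/-- Let `f ∈ ℤ[x]` of degree `n ≥ 1` with leading coefficient `aₙ` be positive at all
positive integers. Then `β = ∑_{d ≥ 1} N(d)/d²` converges and
`∑_{m ≤ x} σ(f(m)) = (β aₙ/(n+1)) x^{n+1} + O(xⁿ (log x)ⁿ)`. -/
theorem stmt_14 (f : Polynomial ℤ) (hdeg : 1 ≤ f.natDegree)
    (hpos : ∀ m : ℕ, 0 < m → 0 < f.eval (m : ℤ)) :
    ∃ β : ℝ, HasSum (fun d : ℕ+ => (rootCount f (d : ℕ) : ℝ) / ((d : ℕ) : ℝ) ^ 2) β ∧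
      ∃ C : ℝ, 0 < C ∧ ∃ x₀ : ℝ, ∀ x : ℝ, x₀ ≤ x →
        |(∑ m ∈ Finset.Icc 1 ⌊x⌋₊, sigmaZ (f.eval (m : ℤ)) : ℝ) -
            β * (f.leadingCoeff : ℝ) / (f.natDegree + 1) * x ^ (f.natDegree + 1)| ≤
          C * x ^ f.natDegree * (Real.log x) ^ f.natDegree := by
  have hf0 : f ≠ 0 := by
    rintro rfl
    simp at hdeg
  obtain ⟨A, hA0, hA⟩ := exists_sum_rootCount_rpow_le hf0
  obtain ⟨β, hβ, hβle, hβtail⟩ := exists_hasSum_rootCount_div_sq hA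
  refine ⟨β, hβ, ?_⟩
  set n := f.natDegree with hn
  set H := coeffSum f with hH
  have hH0 : 0 ≤ H := coeffSum_nonneg f
  set a : ℝ := f.leadingCoeff / (n + 1) with ha
  have hβ0 : 0 ≤ β := (Finset.sum_nonneg fun _ _ => by positivity).trans (hβle 0)
  set C₁ : ℝ := 2 * H * (Real.exp 1 * A * (n + 3) ^ n) with hC₁
  set C₂ : ℝ := β * H + |a| * (A * 3 ^ n) + |β * a| * (n + 1) with hC₂
  refine ⟨C₁ + C₂ + 1, by positivity, H + 4, fun x hx => ?_⟩
  set M := ⌊x⌋₊ with hM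
  have hx0 : 0 ≤ x := by linarith
  have hMx : (M : ℝ) ≤ x := Nat.floor_le hx0
  have hxM : x < M + 1 := Nat.lt_floor_add_one x
  have hMH : H ≤ M := by linarith
  have hM3 : (3 : ℝ) ≤ M := by linarith
  have hMpos : 0 < M := by
    have : (0 : ℝ) < M := by linarith
    exact_mod_cast this
  have hM2 : 2 ≤ M := by
    have : (2 : ℝ) ≤ M := by linarith
    exact_mod_cast this
  have hlog1 : 1 ≤ Real.log x := by
    rw [Real.le_log_iff_exp_le (by linarith)]
    linarith [Real.exp_one_lt_d9]
  have hlogM : Real.log M ≤ Real.log x := Real.log_le_log (by linarith) hMx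
  set D := M ^ (n + 2) with hD
  have hHD : H * (M : ℝ) ^ n ≤ D := by
    rw [hD]
    push_cast
    calc H * (M : ℝ) ^ n ≤ (M : ℝ) ^ 2 * (M : ℝ) ^ n := by
          gcongr
          nlinarith
      _ = _ := by ring
  have hMD : M ^ 2 ≤ D := Nat.pow_le_pow_right hMpos (by omega)
  have hD2 : 2 ≤ D := le_trans (by nlinarith) hMD
  set E := ∑ m ∈ Finset.Icc 1 M, ((f.eval (m : ℤ) : ℤ) : ℝ) with hE
  set S := ∑ d ∈ Finset.Icc 1 D, (rootCount f d : ℝ) / (d : ℝ) ^ 2 with hS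
  have hS0 : 0 ≤ S := Finset.sum_nonneg fun _ _ => by positivity
  have hMn : (M : ℝ) ^ n ≤ x ^ n := by gcongr
  have hlogD : ∑ d ∈ Finset.Icc 1 D, (rootCount f d : ℝ) / d ≤
      Real.exp 1 * A * (n + 3) ^ n * (Real.log x) ^ n := by
    refine (sum_rootCount_div_le hA hD2).trans ?_
    rw [mul_assoc _ _ ((Real.log x) ^ n), ← mul_pow]
    gcongr
    have hlogpow : Real.log D = (n + 2) * Real.log M := by
      rw [hD]
      push_cast
      rw [Real.log_pow]
      push_cast
      rfl
    have : (n + 2) * Real.log M ≤ (n + 2) * Real.log x := by gcongr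
    linarith
  have e₁ : |∑ m ∈ Finset.Icc 1 M, (sigmaZ (f.eval (m : ℤ)) : ℝ) - S * E| ≤
      C₁ * x ^ n * (Real.log x) ^ n := by
    refine (abs_sum_sigmaZ_sub_le hpos hMpos hHD).trans ?_
    calc _ ≤ 2 * H * x ^ n * (Real.exp 1 * A * (n + 3) ^ n * (Real.log x) ^ n) := by gcongr
      _ = _ := by rw [hC₁]; ring
  have e₂ : |S * E - S * (a * (M : ℝ) ^ (n + 1))| ≤ β * H * x ^ n := by
    rw [← mul_sub, abs_mul, abs_of_nonneg hS0, mul_assoc]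
    have := abs_sum_eval_sub_le f hMpos
    exact mul_le_mul (hβle D) (this.trans (by gcongr)) (abs_nonneg _) hβ0
  have e₃ : |S * (a * (M : ℝ) ^ (n + 1)) - β * (a * (M : ℝ) ^ (n + 1))| ≤
      |a| * (A * 3 ^ n) * x ^ n := by
    have h1 : |S - β| ≤ A * 3 ^ n / M := by
      rw [abs_sub_comm, abs_of_nonneg (sub_nonneg.2 (hβle D))]
      exact hβtail M D hMpos hMD
    rw [← sub_mul, abs_mul, abs_mul, abs_of_nonneg (by positivity : (0 : ℝ) ≤ (M : ℝ) ^ (n + 1))]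
    calc |S - β| * (|a| * (M : ℝ) ^ (n + 1)) ≤ A * 3 ^ n / M * (|a| * (M : ℝ) ^ (n + 1)) := by
          gcongr
      _ = |a| * (A * 3 ^ n) * (M : ℝ) ^ n := by
          field_simp
          ring
      _ ≤ _ := by gcongr
  have e₄ : |β * (a * (M : ℝ) ^ (n + 1)) - β * (a * x ^ (n + 1))| ≤
      |β * a| * (n + 1) * x ^ n := by
    have h1 : |(M : ℝ) ^ (n + 1) - x ^ (n + 1)| ≤ (n + 1) * x ^ n := by
      refine (abs_pow_sub_pow_le _ _ _).trans ?_
      rw [Nat.abs_cast, abs_of_nonneg hx0, max_eq_right hMx]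
      have h2 : |(M : ℝ) - x| ≤ 1 := by
        rw [abs_le]
        constructor <;> linarith
      push_cast
      calc |(M : ℝ) - x| * (n + 1) * x ^ n ≤ 1 * (n + 1) * x ^ n := by gcongr
        _ = _ := by ring
    rw [show β * (a * (M : ℝ) ^ (n + 1)) - β * (a * x ^ (n + 1)) =
      β * a * ((M : ℝ) ^ (n + 1) - x ^ (n + 1)) by ring, abs_mul, mul_assoc]
    gcongr
  have hxn : 0 ≤ x ^ n := by positivity
  have hlogn : 1 ≤ (Real.log x) ^ n := one_le_pow₀ hlog1
  have hC₂0 : 0 ≤ C₂ := by positivity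
  have e₅ : C₂ * x ^ n ≤ C₂ * x ^ n * (Real.log x) ^ n :=
    le_mul_of_one_le_right (by positivity) hlogn
  have e₆ : 0 ≤ x ^ n * (Real.log x) ^ n := by positivity
  rw [show β * (f.leadingCoeff : ℝ) / (n + 1) * x ^ (n + 1) = β * (a * x ^ (n + 1)) by
    rw [ha]; ring]
  rw [abs_le] at e₁ e₂ e₃ e₄ ⊢
  have e₇ : C₂ * x ^ n = β * H * x ^ n + |a| * (A * 3 ^ n) * x ^ n + |β * a| * (n + 1) * x ^ n := by
    rw [hC₂]; ring
  have e₈ : (C₁ + C₂ + 1) * x ^ n * (Real.log x) ^ n = C₁ * x ^ n * (Real.log x) ^ n +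
      C₂ * x ^ n * (Real.log x) ^ n + x ^ n * (Real.log x) ^ n := by ring
  rw [e₈]
  constructor <;> linarith [e₁.1, e₁.2, e₂.1, e₂.2, e₃.1, e₃.2, e₄.1, e₄.2]
end
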